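/- Let n ≥ 21 and let s be an integer with 2 ≤ s ≤ 2^(n−1). Set N = (∑_{k=3}^n C(n,k)) + C(n−1,2). A family 𝓐 of subsets of [n] with |𝓐| = N maximises |𝕀^(s)(𝓐)| over all families of subsets of [n] of size N if and only if there is a permutation σ of [n] such that 𝓐 = {σ(A) : A ∈ [n]^(≥3) ∪ {A ∈ [n]^(2) : n ∉ A}} (σ applied elementwise to each set). In particular, the maximising family is unique up to reordering the coordinates. -/

import Mathlib

open Finset

/-- The ground set `[n] = {1, …, n}`. -/
def groundSet (n : ℕ) : Finset ℕ := Finset.Icc 1 n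

/-- All subsets of `[n]`. -/
def allFams (n : ℕ) : Finset (Finset ℕ) := (groundSet n).powerset

/-- `[n]^(≥ r)`: subsets of `[n]` of size at least `r`. -/
def layerGE (n r : ℕ) : Finset (Finset ℕ) := (allFams n).filter fun A => r ≤ A.card

/-- `[n]^(r)`: subsets of `[n]` of size exactly `r`. -/
def layerEQ (n r : ℕ) : Finset (Finset ℕ) := (groundSet n).powersetCard r

/-- `𝕀^(s)(𝓐)`: the intersecting subfamilies of `𝓐` of size `s`. -/
def interFams (s : ℕ) (𝓐 : Finset (Finset ℕ)) : Finset (Finset (Finset ℕ)) :=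
  (𝓐.powersetCard s).filter fun 𝓔 => ∀ B ∈ 𝓔, ∀ B' ∈ 𝓔, (B ∩ B').Nonempty

namespace IntersectingCount

section

section Intersecting

variable {α : Type*} [DecidableEq α]

/-- The family `𝓑` is intersecting. -/
def IsInter (𝓑 : Finset (Finset α)) : Prop := ∀ B ∈ 𝓑, ∀ B' ∈ 𝓑, (B ∩ B').Nonempty

instance (𝓑 : Finset (Finset α)) : Decidable (IsInter 𝓑) := by
  unfold IsInter; infer_instance

lemma IsInter.mono {𝓑 𝓒 : Finset (Finset α)} (h : IsInter 𝓒) (h' : 𝓑 ⊆ 𝓒) : IsInter 𝓑 :=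
  fun B hB B' hB' => h B (h' hB) B' (h' hB')

lemma IsInter.nonempty {𝓑 : Finset (Finset α)} (h : IsInter 𝓑) {B : Finset α} (hB : B ∈ 𝓑) :
    B.Nonempty := by
  simpa using h B hB B hB

lemma isInter_iff_intersecting (𝓑 : Finset (Finset α)) :
    IsInter 𝓑 ↔ (𝓑 : Set (Finset α)).Intersecting := by
  simp only [IsInter, Set.Intersecting, Finset.not_disjoint_iff_nonempty_inter, mem_coe]

lemma card_swap {𝓛 : Finset (Finset α)} {L P : Finset α} (hL : L ∈ 𝓛) (hP : P ∉ 𝓛) :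
    #(insert P (𝓛.erase L)) = #𝓛 := by
  rw [card_insert_of_notMem (fun h => hP (mem_of_mem_erase h)), card_erase_add_one hL]

/-- Enlarging one member of an intersecting family keeps it intersecting. -/
lemma IsInter.replace {𝓑 : Finset (Finset α)} (h : IsInter 𝓑) {A A' : Finset α}
    (hA : A ∈ 𝓑) (hAA' : A ⊆ A') : IsInter (insert A' (𝓑.erase A)) := by
  intro B hB B' hB'
  simp only [mem_insert, mem_erase] at hB hB'
  have key : ∀ C ∈ 𝓑, (A' ∩ C).Nonempty := fun C hC =>
    (h A hA C hC).mono (inter_subset_inter_right hAA')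
  rcases hB with rfl | ⟨-, hB⟩ <;> rcases hB' with rfl | ⟨-, hB'⟩
  · simpa using (h.nonempty hA).mono hAA'
  · exact key _ hB'
  · rw [inter_comm]; exact key _ hB
  · exact h _ hB _ hB'

end Intersecting

variable {α : Type*} [Fintype α] [DecidableEq α]

lemma IsInter.compl_notMem {𝓑 : Finset (Finset α)} (h : IsInter 𝓑) {B : Finset α} (hB : B ∈ 𝓑) :
    Bᶜ ∉ 𝓑 := by
  intro h'
  simpa using h B hB _ h'

/-- The intersecting families of exactly `s` subsets of `α`. -/
def interOfSize (α : Type*) [Fintype α] [DecidableEq α] (s : ℕ) :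
    Finset (Finset (Finset α)) :=
  (univ.powersetCard s).filter IsInter

lemma mem_interOfSize {s : ℕ} {𝓑 : Finset (Finset α)} :
    𝓑 ∈ interOfSize α s ↔ #𝓑 = s ∧ IsInter 𝓑 := by
  simp [interOfSize, mem_powersetCard]

/-- The number of intersecting families of size `s` that avoid `𝓛`. -/
def countAvoiding (s : ℕ) (𝓛 : Finset (Finset α)) : ℕ :=
  #{𝓑 ∈ interOfSize α s | Disjoint 𝓑 𝓛}

/-- `𝓛` maximises `countAvoiding` among the families of its size. -/
def IsBest (s : ℕ) (𝓛 : Finset (Finset α)) : Prop :=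
  ∀ 𝓛' : Finset (Finset α), #𝓛' = #𝓛 → countAvoiding s 𝓛' ≤ countAvoiding s 𝓛

/-- The sets of size at most one together with the pairs through `x`. -/
def starComplement (x : α) : Finset (Finset α) := {T | #T ≤ 1 ∨ #T = 2 ∧ x ∈ T}

lemma exists_maximal_inter [Nonempty α] {𝓕 : Finset (Finset α)} (h : IsInter 𝓕) :
    ∃ 𝓜, 𝓕 ⊆ 𝓜 ∧ IsInter 𝓜 ∧ #𝓜 = 2 ^ (Fintype.card α - 1) := by
  rw [isInter_iff_intersecting] at h
  obtain ⟨t, h1, h2, h3⟩ := h.exists_card_eq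
  refine ⟨t, h1, (isInter_iff_intersecting t).2 h3, ?_⟩
  have h4 : 0 < Fintype.card α := Fintype.card_pos
  obtain ⟨m, hm⟩ : ∃ m, Fintype.card α = m + 1 := ⟨_, (Nat.succ_pred_eq_of_pos h4).symm⟩
  rw [Fintype.card_finset, hm, pow_succ] at h2
  rw [hm, Nat.add_sub_cancel]
  omega

lemma exists_inter_extension [Nonempty α] {s : ℕ} (hs : s ≤ 2 ^ (Fintype.card α - 1))
    {𝓓 𝓕 : Finset (Finset α)} (h : IsInter 𝓕) (hd : 𝓓 ⊆ 𝓕) (hds : #𝓓 ≤ s) :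
    ∃ 𝓑 ∈ interOfSize α s, 𝓓 ⊆ 𝓑 ∧ ∀ M, Mᶜ ∈ 𝓕 → M ∉ 𝓑 := by
  obtain ⟨𝓜, h1, h2, h3⟩ := exists_maximal_inter h
  obtain ⟨𝓑, h4, h5, h6⟩ := exists_subsuperset_card_eq (hd.trans h1) hds (h3 ▸ hs)
  refine ⟨𝓑, mem_interOfSize.2 ⟨h6, h2.mono h5⟩, h4, fun M hM hMB => ?_⟩
  exact h2.compl_notMem (h5 hMB) (h1 hM)

lemma isInter_insert_compl {𝓛 : Finset (Finset α)} {A : Finset α} (hA : A.Nonempty)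
    (h : ∀ M ∈ 𝓛, ¬ A ⊆ M) (h2 : ∀ M ∈ 𝓛, ∀ M' ∈ 𝓛, #M + #M' < Fintype.card α) :
    IsInter (insert A (𝓛.image compl)) := by
  have h3 : ∀ M ∈ 𝓛, (A ∩ Mᶜ).Nonempty := fun M hM => by
    rw [← sdiff_eq_inter_compl, sdiff_nonempty]; exact h M hM
  intro B hB B' hB'
  simp only [mem_insert, mem_image] at hB hB'
  rcases hB with rfl | ⟨M, hM, rfl⟩ <;> rcases hB' with rfl | ⟨M', hM', rfl⟩
  · simpa using hA
  · exact h3 _ hM'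
  · rw [inter_comm]; exact h3 _ hM
  · rw [← compl_union, nonempty_iff_ne_empty, Ne, compl_eq_empty_iff]
    intro hu
    have := card_union_le M M'
    rw [hu, card_univ] at this
    exact absurd (h2 M hM M' hM') (by omega)

lemma countAvoiding_swap (s : ℕ) {𝓛 : Finset (Finset α)} {L : Finset α} (P : Finset α)
    (hL : L ∈ 𝓛) :
    countAvoiding s 𝓛 + #{𝓑 ∈ interOfSize α s | L ∈ 𝓑 ∧ Disjoint 𝓑 (insert P (𝓛.erase L))} =
      countAvoiding s (insert P (𝓛.erase L)) +
        #{𝓑 ∈ interOfSize α s | P ∈ 𝓑 ∧ Disjoint 𝓑 𝓛} := by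
  have e1 : countAvoiding s 𝓛 = #{𝓑 ∈ interOfSize α s | Disjoint 𝓑 (insert P 𝓛)} +
      #{𝓑 ∈ interOfSize α s | P ∈ 𝓑 ∧ Disjoint 𝓑 𝓛} := by
    rw [countAvoiding, ← card_filter_add_card_filter_not (fun 𝓑 => P ∉ 𝓑), filter_filter,
      filter_filter]
    congr 2 <;> ext 𝓑 <;> simp [disjoint_insert_right, and_comm]
  have e2 : countAvoiding s (insert P (𝓛.erase L)) =
      #{𝓑 ∈ interOfSize α s | Disjoint 𝓑 (insert P 𝓛)} +
      #{𝓑 ∈ interOfSize α s | L ∈ 𝓑 ∧ Disjoint 𝓑 (insert P (𝓛.erase L))} := by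
    rw [countAvoiding, ← card_filter_add_card_filter_not (fun 𝓑 => L ∉ 𝓑), filter_filter,
      filter_filter]
    congr 2 <;> ext 𝓑
    · conv_rhs => rw [← insert_erase hL, insert_comm]
      simp only [disjoint_insert_right, mem_filter]
      tauto
    · simp [and_comm]
  omega

lemma IsBest.swap_le {s : ℕ} {𝓛 : Finset (Finset α)} (h : IsBest s 𝓛) {L P : Finset α}
    (hL : L ∈ 𝓛) (hP : P ∉ 𝓛) :
    #{𝓑 ∈ interOfSize α s | L ∈ 𝓑 ∧ Disjoint 𝓑 (insert P (𝓛.erase L))} ≤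
      #{𝓑 ∈ interOfSize α s | P ∈ 𝓑 ∧ Disjoint 𝓑 𝓛} := by
  have h1 := countAvoiding_swap s P hL
  have h2 := h _ (card_swap hL hP)
  omega

lemma IsBest.swap {s : ℕ} {𝓛 : Finset (Finset α)} (h : IsBest s 𝓛) {L P : Finset α}
    (hL : L ∈ 𝓛) (hP : P ∉ 𝓛)
    (hle : #{𝓑 ∈ interOfSize α s | P ∈ 𝓑 ∧ Disjoint 𝓑 𝓛} ≤
      #{𝓑 ∈ interOfSize α s | L ∈ 𝓑 ∧ Disjoint 𝓑 (insert P (𝓛.erase L))}) :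
    IsBest s (insert P (𝓛.erase L)) := by
  intro 𝓛' h'
  rw [card_swap hL hP] at h'
  have h1 := countAvoiding_swap s P hL
  have h2 := h _ h'
  omega

lemma isBest_upward_swap_le (s : ℕ) {𝓛 : Finset (Finset α)} {A A' : Finset α} (hA : A ∉ 𝓛)
    (hA' : A' ∈ 𝓛) (hAA' : A ⊆ A') :
    Set.MapsTo (fun 𝓑 : Finset (Finset α) => insert A' (𝓑.erase A))
      ({𝓑 ∈ interOfSize α s | A ∈ 𝓑 ∧ Disjoint 𝓑 𝓛} : Finset _)
      ({𝓑 ∈ interOfSize α s | A' ∈ 𝓑 ∧ Disjoint 𝓑 (insert A (𝓛.erase A'))} : Finset _) ∧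
    Set.InjOn (fun 𝓑 : Finset (Finset α) => insert A' (𝓑.erase A))
      ({𝓑 ∈ interOfSize α s | A ∈ 𝓑 ∧ Disjoint 𝓑 𝓛} : Finset _) := by
  have hne : A ≠ A' := fun h => hA (h ▸ hA')
  constructor
  · intro 𝓑 h𝓑
    simp only [coe_filter, Set.mem_ofPred_eq, mem_interOfSize] at h𝓑 ⊢
    obtain ⟨⟨h1, h2⟩, h3, h4⟩ := h𝓑
    have h5 : A' ∉ 𝓑 := disjoint_right.1 h4 hA'
    refine ⟨⟨?_, h2.replace h3 hAA'⟩, mem_insert_self _ _, ?_⟩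
    · rw [card_insert_of_notMem (fun h => h5 (mem_of_mem_erase h)), card_erase_add_one h3, h1]
    · rw [disjoint_insert_right, disjoint_insert_left]
      refine ⟨by simp [hne], by simp, ?_⟩
      exact (h4.mono_left (erase_subset _ _)).mono_right (erase_subset _ _)
  · intro 𝓑 h𝓑 𝓒 h𝓒 h
    simp only [coe_filter, Set.mem_ofPred_eq] at h𝓑 h𝓒 h
    have h5 : A' ∉ 𝓑.erase A := fun h => disjoint_right.1 h𝓑.2.2 hA' (mem_of_mem_erase h)
    have h6 : A' ∉ 𝓒.erase A := fun h => disjoint_right.1 h𝓒.2.2 hA' (mem_of_mem_erase h)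
    have h7 : 𝓑.erase A = 𝓒.erase A := by
      rw [← erase_insert h5, ← erase_insert h6, h]
    rw [← insert_erase h𝓑.2.1, ← insert_erase h𝓒.2.1, h7]

lemma card_le_two_of_mem_starComplement {x : α} {T : Finset α} (h : T ∈ starComplement x) :
    #T ≤ 2 := by
  simp only [starComplement, mem_filter, mem_univ, true_and] at h
  omega

lemma starComplement_down {x : α} {S T : Finset α} (h : T ∈ starComplement x) (hST : S ⊆ T) :
    S ∈ starComplement x := by
  simp only [starComplement, mem_filter, mem_univ, true_and] at h ⊢
  have := card_le_card hST
  by_cases hc : #S ≤ 1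
  · exact Or.inl hc
  · have : S = T := eq_of_subset_of_card_le hST (by omega)
    subst this; exact h

/-- If every optimal downset is a star complement then so is every optimal family. -/
lemma isBest_of_downsets {s : ℕ} (hs1 : 2 ≤ s) (hs2 : s ≤ 2 ^ (Fintype.card α - 1))
    (hn : 5 ≤ Fintype.card α) (m : ℕ)
    (key : ∀ 𝓛 : Finset (Finset α), #𝓛 = m → IsBest s 𝓛 →
      (∀ L ∈ 𝓛, ∀ A ⊆ L, A ∈ 𝓛) → ∃ x, 𝓛 = starComplement x)
    (𝓛 : Finset (Finset α)) (h𝓛 : #𝓛 = m) (hbest : IsBest s 𝓛) : ∃ x, 𝓛 = starComplement x := by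
  have : Nonempty α := Fintype.card_pos_iff.1 (by omega)
  induction hk : ∑ L ∈ 𝓛, #L using Nat.strong_induction_on generalizing 𝓛 with
  | _ k ih =>
  subst hk
  by_contra hno
  have hnd : ¬ ∀ L ∈ 𝓛, ∀ A ⊆ L, A ∈ 𝓛 := fun h => hno (key 𝓛 h𝓛 hbest h)
  push Not at hnd
  obtain ⟨A', hA', A, hAA', hA⟩ := hnd
  obtain ⟨hmaps, hinj⟩ := isBest_upward_swap_le s hA hA' hAA'
  have hbest' := hbest.swap hA' hA (card_le_card_of_injOn _ hmaps hinj)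
  have hne : A ≠ A' := fun h => hA (h ▸ hA')
  have hlt : #A < #A' := card_lt_card (hAA'.ssubset_of_ne hne)
  have hA2 : A ∉ 𝓛.erase A' := fun h => hA (mem_of_mem_erase h)
  obtain ⟨x, hx⟩ := ih _ (by
    rw [sum_insert hA2, ← add_sum_erase 𝓛 _ hA']
    omega) _ ((card_swap hA' hA).trans h𝓛) hbest' rfl
  have hA'n : A' ∉ starComplement x := by
    rw [← hx]; simp [hne.symm]
  have hAx : A ∈ starComplement x := by rw [← hx]; simp
  have hF := isInter_insert_compl (𝓛 := starComplement x) (A := A')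
    (card_pos.1 (by omega)) (fun M hM h => hA'n (starComplement_down hM h)) (fun M hM M' hM' => by
      have := card_le_two_of_mem_starComplement hM
      have := card_le_two_of_mem_starComplement hM'
      omega)
  obtain ⟨𝓑, hB, hdB, hav⟩ := exists_inter_extension hs2 hF (𝓓 := {A', Aᶜ}) (by
    intro T hT
    simp only [mem_insert, mem_singleton] at hT
    rcases hT with rfl | rfl
    · simp
    · exact mem_insert_of_mem (mem_image_of_mem _ hAx)) (card_le_two.trans hs1)
  have h3 := hbest.swap_le hA' hA
  refine absurd h3 (not_le.2 ?_)
  have h𝓑 : 𝓑 ∈ ({𝓑 ∈ interOfSize α s | A' ∈ 𝓑 ∧ Disjoint 𝓑 (insert A (𝓛.erase A'))} :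
      Finset _) := by
    rw [hx, mem_filter]
    refine ⟨hB, hdB (by simp), disjoint_right.2 fun M hM => hav M ?_⟩
    exact mem_insert_of_mem (mem_image_of_mem _ hM)
  rw [← card_image_of_injOn hinj]
  refine card_lt_card ⟨?_, fun hsub => ?_⟩
  · intro T hT
    obtain ⟨U, hU, rfl⟩ := mem_image.1 hT
    exact hmaps hU
  obtain ⟨𝓒, h𝓒, h⟩ := mem_image.1 (hsub h𝓑)
  simp only [mem_filter, mem_interOfSize] at h𝓒
  have h4 : Aᶜ ∈ insert A' (𝓒.erase A) := by rw [h]; exact hdB (by simp)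
  rcases mem_insert.1 h4 with h5 | h5
  · have h6 := h𝓒.1.2.nonempty h𝓒.2.1
    obtain ⟨y, hy⟩ := h6
    have := hAA' hy
    rw [← h5] at this
    simp [hy] at this
  · exact h𝓒.1.2.compl_notMem h𝓒.2.1 (mem_of_mem_erase h5)

end

section

section

lemma two_pow_card_le_of_down {β : Type*} {𝓛 : Finset (Finset β)} (hdown : ∀ L ∈ 𝓛, ∀ A ⊆ L, A ∈ 𝓛)
    {L : Finset β} (hL : L ∈ 𝓛) : 2 ^ #L ≤ #𝓛 := by
  rw [← card_powerset]
  exact card_le_card fun A hA => hdown L hL A (mem_powerset.1 hA)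

variable {β : Type*} [DecidableEq β]

lemma IsInter.insert {𝓕 : Finset (Finset β)} (h : IsInter 𝓕) {C : Finset β} (hC : C.Nonempty)
    (hC' : ∀ T ∈ 𝓕, (C ∩ T).Nonempty) : IsInter (insert C 𝓕) := by
  intro B hB B' hB'
  rcases mem_insert.1 hB with rfl | h1 <;> rcases mem_insert.1 hB' with rfl | h2
  · simpa using hC
  · exact hC' _ h2
  · rw [inter_comm]; exact hC' _ h1
  · exact h _ h1 _ h2

lemma card_filter_mem_powersetCard {𝓜 : Finset β} {A : β} (hA : A ∈ 𝓜) (s : ℕ) :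
    #{𝓑 ∈ 𝓜.powersetCard (s + 1) | A ∈ 𝓑} = (#𝓜 - 1).choose s := by
  rw [← card_erase_of_mem hA, ← card_powersetCard]
  refine card_nbij' (fun 𝓑 => 𝓑.erase A) (fun 𝓑 => insert A 𝓑) ?_ ?_ ?_ ?_
  · intro 𝓑 h
    simp only [coe_filter, mem_powersetCard, Set.mem_ofPred_eq, mem_coe] at h ⊢
    exact ⟨erase_subset_erase _ h.1.1, by rw [card_erase_of_mem h.2]; omega⟩
  · intro 𝓑 h
    simp only [coe_filter, mem_powersetCard, Set.mem_ofPred_eq, mem_coe] at h ⊢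
    refine ⟨⟨insert_subset hA (h.1.trans (erase_subset _ _)), ?_⟩, mem_insert_self _ _⟩
    rw [card_insert_of_notMem (fun h' => by simpa using h.1 h'), h.2]
  · intro 𝓑 h
    simp only [coe_filter, Set.mem_ofPred_eq] at h
    exact insert_erase h.2
  · intro 𝓑 h
    simp only [mem_powersetCard, mem_coe] at h
    exact erase_insert (fun h' => by simpa using h.1 h')

end

variable {α : Type*} [Fintype α] [DecidableEq α]

lemma two_mul_add_two_le {l n : ℕ} (hn : 21 ≤ n) (h : 2 ^ l ≤ 2 * n) : 2 * l + 2 ≤ n := by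
  by_contra hc
  have h1 : ∀ k, 5 ≤ k → 4 * k + 2 < 2 ^ k := by
    intro k hk
    induction k, hk using Nat.le_induction with
    | base => norm_num
    | succ k hk ih => rw [pow_succ]; omega
  have := h1 l (by omega)
  omega

lemma IsInter.two_mul_card_le {𝓕 : Finset (Finset α)} (h : IsInter 𝓕) :
    2 * #𝓕 ≤ 2 ^ Fintype.card α := by
  rw [← Fintype.card_finset]
  exact ((isInter_iff_intersecting 𝓕).1 h).card_le

lemma card_through_singleton_le (s : ℕ) (x : α) :
    #{𝓑 ∈ interOfSize α (s + 1) | {x} ∈ 𝓑} ≤ (2 ^ (Fintype.card α - 1) - 1).choose s := by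
  set 𝓢 : Finset (Finset α) := {T | x ∈ T} with h𝓢
  have hS : IsInter 𝓢 := fun B hB B' hB' => ⟨x, by simp [h𝓢] at hB hB'; simp [hB, hB']⟩
  have hc : #𝓢 ≤ 2 ^ (Fintype.card α - 1) := by
    have h1 := hS.two_mul_card_le
    obtain ⟨m, hm⟩ : ∃ m, Fintype.card α = m + 1 :=
      ⟨_, (Nat.succ_pred_eq_of_pos (Fintype.card_pos_iff.2 ⟨x⟩)).symm⟩
    rw [hm, pow_succ] at h1
    rw [hm, Nat.add_sub_cancel]
    omega
  have hx : {x} ∈ 𝓢 := by simp [h𝓢]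
  calc _ ≤ #{𝓑 ∈ 𝓢.powersetCard (s + 1) | {x} ∈ 𝓑} := by
        refine card_le_card fun 𝓑 h => ?_
        simp only [mem_filter, mem_interOfSize, mem_powersetCard] at h ⊢
        refine ⟨⟨fun T hT => ?_, h.1.1⟩, h.2⟩
        obtain ⟨y, hy⟩ := h.1.2 _ h.2 _ hT
        simp only [mem_inter, mem_singleton] at hy
        simp [h𝓢, ← hy.1, hy.2]
    _ = (#𝓢 - 1).choose s := card_filter_mem_powersetCard hx s
    _ ≤ _ := Nat.choose_le_choose s (by omega)

lemma card_filter_card_le_one : #{T : Finset α | #T ≤ 1} = Fintype.card α + 1 := by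
  have h : ({T : Finset α | #T ≤ 1} : Finset _) =
      (univ : Finset α).powersetCard 0 ∪ univ.powersetCard 1 := by
    ext T
    simp only [mem_filter, mem_univ, true_and, mem_union, mem_powersetCard, subset_univ]
    omega
  rw [h, card_union_of_disjoint (pairwise_disjoint_powersetCard _ (by norm_num))]
  simp [add_comm]

/-- An optimal downset contains every singleton. -/
lemma IsBest.singleton_mem {s : ℕ} (hs1 : 2 ≤ s) (hs2 : s ≤ 2 ^ (Fintype.card α - 1))
    (hn : 4 ≤ Fintype.card α) {𝓛 : Finset (Finset α)} (hbest : IsBest s 𝓛)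
    (hcard : Fintype.card α + 1 < #𝓛) (hsize : ∀ L ∈ 𝓛, 2 * #L + 2 ≤ Fintype.card α) (x : α) :
    {x} ∈ 𝓛 := by
  have : Nonempty α := ⟨x⟩
  by_contra hx
  obtain ⟨L, hL, hmax⟩ := exists_max_image 𝓛 card (card_pos.1 (by omega))
  have hL2 : 1 < #L := by
    by_contra hc
    have : 𝓛 ⊆ ({T : Finset α | #T ≤ 1} : Finset _) := fun T hT => by
      simpa using (hmax T hT).trans (not_lt.1 hc)
    have := card_le_card this
    rw [card_filter_card_le_one] at this
    omega
  obtain ⟨p, hp, q, hq, hpq⟩ := one_lt_card.1 hL2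
  obtain ⟨C, hpC, hCq, hC⟩ := exists_subsuperset_card_eq (s := {p}) (t := univ.erase q)
    (n := Fintype.card α / 2) (by simpa using hpq)
    (by rw [card_singleton]; omega) (by rw [card_erase_of_mem (mem_univ _), card_univ]; omega)
  have hpC' : p ∈ C := hpC (by simp)
  have hqC : q ∉ C := fun h => by simpa using hCq h
  set 𝓛' := insert {x} (𝓛.erase L) with h𝓛'
  have hsize' : ∀ M ∈ 𝓛', 2 * #M + 2 ≤ Fintype.card α := by
    intro M hM
    rcases mem_insert.1 hM with rfl | hM
    · simpa using hn
    · exact hsize M (mem_of_mem_erase hM)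
  have hF := isInter_insert_compl (𝓛 := 𝓛') (A := L) ⟨p, hp⟩ (by
    intro M hM hLM
    rcases mem_insert.1 hM with rfl | hM
    · exact absurd (card_le_card hLM) (by rw [card_singleton]; omega)
    · exact (mem_erase.1 hM).1 (eq_of_subset_of_card_le hLM (hmax M (mem_of_mem_erase hM))).symm)
    (fun M hM M' hM' => by have := hsize' M hM; have := hsize' M' hM'; omega)
  set 𝓕 := insert L (𝓛'.image compl) with h𝓕
  have hLF : L ∈ 𝓕 := mem_insert_self _ _
  have hbig : ∀ D : Finset α, (D ∩ L).Nonempty → Fintype.card α / 2 ≤ #D →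
      IsInter (insert D 𝓕) := by
    intro D hD hDc
    refine hF.insert (hD.mono inter_subset_left) fun T hT => ?_
    rcases mem_insert.1 hT with rfl | hT
    · exact hD
    · obtain ⟨M, hM, rfl⟩ := mem_image.1 hT
      rw [← sdiff_eq_inter_compl, sdiff_nonempty]
      intro hDM
      have := card_le_card hDM
      have := hsize' M hM
      omega
  have h1 := hbig C ⟨p, by simp [hp, hpC']⟩ hC.ge
  have h2 := hbig Cᶜ ⟨q, by simp [hq, hqC]⟩ (by rw [card_compl, hC]; omega)
  obtain ⟨𝓜, hM1, hM2, hM3⟩ := exists_maximal_inter h1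
  obtain ⟨𝓑, hB1, hB2, hB3⟩ := exists_inter_extension hs2 h2 (𝓓 := {Cᶜ, L}) (by
    intro T hT
    simp only [mem_insert, mem_singleton] at hT
    rcases hT with rfl | rfl
    · exact mem_insert_self _ _
    · exact mem_insert_of_mem hLF) (card_le_two.trans hs1)
  have hmemF : ∀ M ∈ 𝓛', Mᶜ ∈ 𝓕 := fun M hM => mem_insert_of_mem (mem_image_of_mem _ hM)
  obtain ⟨s, rfl⟩ : ∃ t, s = t + 1 := ⟨s - 1, by omega⟩
  refine absurd (hbest.swap_le hL hx) (not_le.2 ?_)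
  calc _ ≤ #{𝓑 ∈ interOfSize α (s + 1) | {x} ∈ 𝓑} :=
        card_le_card fun 𝓑 h => by
          simp only [mem_filter] at h ⊢
          exact ⟨h.1, h.2.1⟩
    _ ≤ (2 ^ (Fintype.card α - 1) - 1).choose s := card_through_singleton_le s x
    _ = #{𝓑 ∈ 𝓜.powersetCard (s + 1) | L ∈ 𝓑} := by
        rw [card_filter_mem_powersetCard (hM1 (mem_insert_of_mem hLF)), hM3]
    _ < #(insert 𝓑 {𝓑 ∈ 𝓜.powersetCard (s + 1) | L ∈ 𝓑}) := by
        rw [card_insert_of_notMem]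
        · exact Nat.lt_succ_self _
        · intro h
          simp only [mem_filter, mem_powersetCard] at h
          exact hM2.compl_notMem (hM1 (mem_insert_self _ _)) (h.1.1 (hB2 (by simp)))
    _ ≤ _ := by
        refine card_le_card fun 𝓒 h𝓒 => ?_
        rcases mem_insert.1 h𝓒 with rfl | h
        · refine mem_filter.2 ⟨hB1, hB2 (by simp), disjoint_right.2 fun M hM => hB3 M ?_⟩
          exact mem_insert_of_mem (hmemF M hM)
        · simp only [mem_filter, mem_powersetCard] at h
          refine mem_filter.2 ⟨mem_interOfSize.2 ⟨h.1.2, hM2.mono h.1.1⟩, h.2,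
            disjoint_right.2 fun M hM hM' => ?_⟩
          exact hM2.compl_notMem (h.1.1 hM') (hM1 (mem_insert_of_mem (hmemF M hM)))

end

section

section

variable {β : Type*}

/-- A permutation of the points acting on families. -/
def permFam (e : Equiv.Perm β) : Equiv.Perm (Finset (Finset β)) := e.finsetCongr.finsetCongr

lemma card_permFam (e : Equiv.Perm β) (𝓑 : Finset (Finset β)) : #(permFam e 𝓑) = #𝓑 := by
  simp [permFam, Equiv.finsetCongr]

lemma permFam_subset {e : Equiv.Perm β} {𝓑 𝓒 : Finset (Finset β)} :
    permFam e 𝓑 ⊆ permFam e 𝓒 ↔ 𝓑 ⊆ 𝓒 := by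
  simp [permFam, Equiv.finsetCongr]

lemma disjoint_permFam {e : Equiv.Perm β} {𝓑 𝓒 : Finset (Finset β)} :
    Disjoint (permFam e 𝓑) (permFam e 𝓒) ↔ Disjoint 𝓑 𝓒 := by
  simp [permFam, Equiv.finsetCongr]

lemma mem_permFam {e : Equiv.Perm β} {𝓑 : Finset (Finset β)} {T : Finset β} :
    T ∈ permFam e 𝓑 ↔ ∃ U ∈ 𝓑, U.map e.toEmbedding = T := by
  rw [permFam, Equiv.finsetCongr_apply, mem_map]
  simp [Equiv.finsetCongr_apply]

lemma map_mem_permFam {e : Equiv.Perm β} {𝓑 : Finset (Finset β)} {T : Finset β} :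
    T.map e.toEmbedding ∈ permFam e 𝓑 ↔ T ∈ 𝓑 := by
  simp [mem_permFam, map_inj]

variable [DecidableEq β]

/-- The pairs `{x, y}` with `y ∈ S`. -/
def starPairs (x : β) (S : Finset β) : Finset (Finset β) := S.image fun y => {x, y}

lemma pair_right_injective (x : β) : Function.Injective fun y : β => ({x, y} : Finset β) := by
  intro y z h
  have h1 : y ∈ ({x, z} : Finset β) := by rw [← show ({x, y} : Finset β) = {x, z} from h]; simp
  have h2 : z ∈ ({x, y} : Finset β) := by rw [show ({x, y} : Finset β) = {x, z} from h]; simp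
  simp only [mem_insert, mem_singleton] at h1 h2
  grind

lemma isInter_permFam {e : Equiv.Perm β} {𝓑 : Finset (Finset β)} :
    IsInter (permFam e 𝓑) ↔ IsInter 𝓑 := by
  constructor
  · intro h B hB B' hB'
    have := h _ (map_mem_permFam.2 hB) _ (map_mem_permFam.2 hB')
    rwa [← map_inter, map_nonempty] at this
  · intro h B hB B' hB'
    obtain ⟨C, hC, rfl⟩ := mem_permFam.1 hB
    obtain ⟨C', hC', rfl⟩ := mem_permFam.1 hB'
    rw [← map_inter, map_nonempty]
    exact h C hC C' hC'

lemma permFam_starPairs (e : Equiv.Perm β) (x : β) (S : Finset β) :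
    permFam e (starPairs x S) = starPairs (e x) (S.map e.toEmbedding) := by
  ext T
  simp only [mem_permFam, starPairs, mem_image, mem_map, Equiv.coe_toEmbedding]
  constructor
  · rintro ⟨_, ⟨y, hy, rfl⟩, rfl⟩
    exact ⟨e y, ⟨y, hy, rfl⟩, by simp⟩
  · rintro ⟨_, ⟨y, hy, rfl⟩, rfl⟩
    exact ⟨{x, y}, ⟨y, hy, rfl⟩, by simp⟩

end

variable {α : Type*} [Fintype α] [DecidableEq α]

lemma permFam_starComplement (e : Equiv.Perm α) (x : α) :
    permFam e (starComplement x) = starComplement (e x) := by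
  ext T
  simp only [mem_permFam, starComplement, mem_filter, mem_univ, true_and]
  constructor
  · rintro ⟨U, hU, rfl⟩
    simpa using hU
  · intro h
    refine ⟨T.map e.symm.toEmbedding, ?_, ?_⟩
    · simpa [mem_map, Equiv.symm_apply_eq] using h
    · rw [map_map]
      convert map_refl
      ext; simp

lemma countAvoiding_permFam (s : ℕ) (e : Equiv.Perm α) (𝓛 : Finset (Finset α)) :
    countAvoiding s (permFam e 𝓛) = countAvoiding s 𝓛 := by
  symm
  refine card_equiv (permFam e) fun 𝓑 => ?_
  simp only [mem_filter, mem_interOfSize, card_permFam, isInter_permFam, disjoint_permFam]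

/-- The intersecting families of size `s` without sets of size at most one. -/
def thickFams (α : Type*) [Fintype α] [DecidableEq α] (s : ℕ) : Finset (Finset (Finset α)) :=
  {𝓑 ∈ interOfSize α s | ∀ T ∈ 𝓑, 2 ≤ #T}

lemma mem_thickFams {s : ℕ} {𝓑 : Finset (Finset α)} :
    𝓑 ∈ thickFams α s ↔ #𝓑 = s ∧ IsInter 𝓑 ∧ ∀ T ∈ 𝓑, 2 ≤ #T := by
  simp [thickFams, mem_interOfSize, and_assoc]

/-- The number of families in `thickFams α s` that contain `𝓗`. -/
def numContaining (s : ℕ) (𝓗 : Finset (Finset α)) : ℕ := #{𝓑 ∈ thickFams α s | 𝓗 ⊆ 𝓑}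

lemma numContaining_permFam (s : ℕ) (e : Equiv.Perm α) (𝓗 : Finset (Finset α)) :
    numContaining s (permFam e 𝓗) = numContaining s 𝓗 := by
  symm
  refine card_equiv (permFam e) fun 𝓑 => ?_
  simp only [mem_filter, mem_thickFams, card_permFam, isInter_permFam, permFam_subset]
  simp [mem_permFam]

lemma exists_perm_map_eq {x x' : α} {S S' : Finset α} (hx : x ∉ S) (hx' : x' ∉ S')
    (h : #S = #S') : ∃ e : Equiv.Perm α, e x = x' ∧ S.map e.toEmbedding = S' := by
  let f : {y // y ∈ S} ≃ {y // y ∈ S'} := equivOfCardEq h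
  have h1 : ∀ y ∈ S, f.extendSubtype y ∈ S' := fun y hy => f.extendSubtype_mem y hy
  have h2 : f.extendSubtype x ∉ S' := f.extendSubtype_not_mem x hx
  refine ⟨f.extendSubtype.trans (Equiv.swap (f.extendSubtype x) x'), by simp, ?_⟩
  refine eq_of_subset_of_card_le (fun z hz => ?_) (by rw [card_map, h])
  obtain ⟨y, hy, rfl⟩ := mem_map.1 hz
  have h3 := h1 y hy
  simp only [Equiv.coe_toEmbedding, Equiv.trans_apply]
  rw [Equiv.swap_apply_of_ne_of_ne]
  · exact h3
  · rintro h4; exact h2 (h4 ▸ h3)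
  · rintro h4; exact hx' (h4 ▸ h3)

/-- The common value of `numContaining` at the stars with `k` leaves. -/
def starNum (α : Type*) [Fintype α] [DecidableEq α] (s k : ℕ) : ℕ :=
  ({p : α × Finset α | p.1 ∉ p.2 ∧ #p.2 = k} : Finset _).sup
    fun p => numContaining s (starPairs p.1 p.2)

lemma numContaining_starPairs (s : ℕ) {x : α} {S : Finset α} (hx : x ∉ S) :
    numContaining s (starPairs x S) = starNum α s #S := by
  refine le_antisymm (le_sup (f := fun p : α × Finset α => numContaining s (starPairs p.1 p.2))
    (b := (x, S)) (by simp [hx])) (Finset.sup_le fun p hp => ?_)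
  simp only [mem_filter, mem_univ, true_and] at hp
  obtain ⟨e, he, he'⟩ := exists_perm_map_eq hp.1 hx hp.2
  rw [← numContaining_permFam s e, permFam_starPairs, he, he']

lemma numContaining_pair (s : ℕ) {P : Finset α} (hP : #P = 2) :
    numContaining s {P} = starNum α s 1 := by
  obtain ⟨x, y, hxy, rfl⟩ := card_eq_two.1 hP
  simpa [starPairs] using numContaining_starPairs s (x := x) (S := {y}) (by simpa using hxy)

lemma numContaining_two (s : ℕ) {x y z : α} (hxy : x ≠ y) (hxz : x ≠ z) (hyz : y ≠ z) :
    numContaining s {{x, y}, {x, z}} = starNum α s 2 := by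
  have := numContaining_starPairs s (x := x) (S := {y, z}) (by simp [hxy, hxz])
  rwa [starPairs, image_insert, image_singleton, card_pair hyz] at this

/-- Two pairs are contained in at most `starNum α s 2` thick families. -/
lemma numContaining_two_le (s : ℕ) {P Q : Finset α} (hP : #P = 2) (hQ : #Q = 2) (hPQ : P ≠ Q) :
    numContaining s {P, Q} ≤ starNum α s 2 := by
  by_cases hd : (P ∩ Q).Nonempty
  · obtain ⟨x, hx⟩ := hd
    obtain ⟨hxP, hxQ⟩ := mem_inter.1 hx
    obtain ⟨y, hy⟩ := card_eq_one.1 (show #(P.erase x) = 1 by rw [card_erase_of_mem hxP, hP])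
    obtain ⟨z, hz⟩ := card_eq_one.1 (show #(Q.erase x) = 1 by rw [card_erase_of_mem hxQ, hQ])
    obtain rfl : P = {x, y} := by rw [← hy, insert_erase hxP]
    obtain rfl : Q = {x, z} := by rw [← hz, insert_erase hxQ]
    refine (numContaining_two s ?_ ?_ ?_).le
    · rintro rfl; simp at hP
    · rintro rfl; simp at hQ
    · rintro rfl; exact hPQ rfl
  · refine le_of_eq_of_le (card_eq_zero.2 ?_) (Nat.zero_le _)
    refine filter_eq_empty_iff.2 fun 𝓑 h𝓑 h => hd ?_
    exact (mem_thickFams.1 h𝓑).2.1 _ (h (by simp)) _ (h (by simp))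

lemma starNum_two_pos {s : ℕ} (hs1 : 2 ≤ s) (hs2 : s ≤ 2 ^ (Fintype.card α - 1))
    (hn : 4 ≤ Fintype.card α) : 0 < starNum α s 2 := by
  obtain ⟨U, -, hU⟩ := exists_subset_card_eq (s := (univ : Finset α)) (n := 3)
    (by rw [card_univ]; omega)
  obtain ⟨x, y, z, hxy, hxz, hyz, -⟩ := card_eq_three.1 hU
  have : Nonempty α := ⟨x⟩
  have hF := isInter_insert_compl (𝓛 := ({T | #T ≤ 1} : Finset _)) (A := {x, y}) (by simp)
    (fun M hM h => by
      have := card_le_card h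
      rw [card_pair hxy] at this
      simp at hM; omega)
    (fun M hM M' hM' => by simp at hM hM'; omega)
  have hF' := hF.insert (C := {x, z}) (by simp) (fun T hT => by
    rcases mem_insert.1 hT with rfl | hT
    · exact ⟨x, by simp⟩
    · obtain ⟨M, hM, rfl⟩ := mem_image.1 hT
      rw [← sdiff_eq_inter_compl, sdiff_nonempty]
      intro h
      have := card_le_card h
      rw [card_pair hxz] at this
      simp at hM; omega)
  obtain ⟨𝓑, hB, hd, hav⟩ := exists_inter_extension hs2 hF' (𝓓 := {{x, y}, {x, z}}) (by
    intro T hT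
    simp only [mem_insert, mem_singleton] at hT ⊢
    tauto) (card_le_two.trans hs1)
  rw [← numContaining_two s hxy hxz hyz]
  refine card_pos.2 ⟨𝓑, mem_filter.2 ⟨mem_filter.2 ⟨hB, fun T hT => ?_⟩, hd⟩⟩
  by_contra hc
  refine hav T (mem_insert_of_mem (mem_insert_of_mem (mem_image_of_mem _ ?_))) hT
  simp; omega

end

section

section

variable {β : Type*} [DecidableEq β]

/-- Exchanges `{x}` and `V` as traces on `insert x V`. -/
def flipTrace (x : β) (V T : Finset β) : Finset β :=
  if x ∈ T ∧ Disjoint V T then V ∪ T.erase x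
  else if x ∉ T ∧ V ⊆ T then insert x (T \ V) else T

lemma flipTrace_of_mem {x : β} {V T : Finset β} (hx : x ∈ T) (hV : Disjoint V T) :
    flipTrace x V T = V ∪ T.erase x := if_pos ⟨hx, hV⟩

lemma flipTrace_of_notMem {x : β} {V T : Finset β} (hx : x ∉ T) (hV : V ⊆ T) :
    flipTrace x V T = insert x (T \ V) := by
  rw [flipTrace, if_neg (fun h => hx h.1), if_pos ⟨hx, hV⟩]

lemma flipTrace_of_mem_of_not_disjoint {x : β} {V T : Finset β} (hx : x ∈ T)
    (hV : ¬ Disjoint V T) : flipTrace x V T = T := by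
  rw [flipTrace, if_neg (fun h => hV h.2), if_neg (fun h => h.1 hx)]

lemma flipTrace_involutive {x : β} {V : Finset β} (hx : x ∉ V) :
    Function.Involutive (flipTrace x V) := by
  intro T
  by_cases h1 : x ∈ T ∧ Disjoint V T
  · rw [flipTrace_of_mem h1.1 h1.2, flipTrace_of_notMem (by simp [hx]) subset_union_left,
      union_sdiff_left, sdiff_eq_self_of_disjoint, insert_erase h1.1]
    exact (h1.2.mono_right (erase_subset _ _)).symm
  · by_cases h2 : x ∉ T ∧ V ⊆ T
    · rw [flipTrace_of_notMem h2.1 h2.2, flipTrace_of_mem (mem_insert_self _ _)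
        (by simp [disjoint_insert_right, hx, disjoint_sdiff]), erase_insert (by simp [h2.1]),
        union_sdiff_of_subset h2.2]
    · have : flipTrace x V T = T := by rw [flipTrace, if_neg h1, if_neg h2]
      rw [this, this]

/-- A member of an intersecting family containing a star contains the centre or all leaves. -/
lemma IsInter.mem_or_subset {𝓑 : Finset (Finset β)} (h : IsInter 𝓑) {x : β} {V T : Finset β}
    (hs : starPairs x V ⊆ 𝓑) (hT : T ∈ 𝓑) : x ∈ T ∨ V ⊆ T := by
  by_contra! hc
  refine hc.2 fun y hy => ?_
  obtain ⟨z, hz⟩ := h _ (hs (mem_image_of_mem _ hy)) _ hT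
  simp only [mem_inter, mem_insert, mem_singleton] at hz
  rcases hz with ⟨rfl | rfl, hz⟩
  · exact absurd hz hc.1
  · exact hz

lemma flipTrace_pair {x y : β} {V : Finset β} (hy : y ∈ V) : flipTrace x V {x, y} = {x, y} :=
  flipTrace_of_mem_of_not_disjoint (by simp) (by
    rw [not_disjoint_iff]; exact ⟨y, hy, by simp⟩)

lemma IsInter.flipTrace {𝓑 : Finset (Finset β)} (h : IsInter 𝓑) {x : β} {V : Finset β}
    (hV : V.Nonempty) (hs : starPairs x V ⊆ 𝓑) :
    IsInter (𝓑.image (flipTrace x V)) := by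
  have main : ∀ T ∈ 𝓑, ∀ T' ∈ 𝓑, x ∈ T →
      (IntersectingCount.flipTrace x V T ∩ IntersectingCount.flipTrace x V T').Nonempty := by
    intro T hT T' hT' hxT
    obtain ⟨v, hv⟩ := hV
    by_cases hd : Disjoint V T
    · rw [flipTrace_of_mem hxT hd]
      by_cases hxT' : x ∈ T'
      · by_cases hd' : Disjoint V T'
        · rw [flipTrace_of_mem hxT' hd']
          exact ⟨v, by simp [hv]⟩
        · rw [flipTrace_of_mem_of_not_disjoint hxT' hd']
          obtain ⟨y, hy, hy'⟩ := not_disjoint_iff.1 hd'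
          exact ⟨y, by simp [hy, hy']⟩
      · have hVT' := (h.mem_or_subset hs hT').resolve_left hxT'
        rw [flipTrace_of_notMem hxT' hVT']
        obtain ⟨y, hy⟩ := h _ hT _ hT'
        obtain ⟨hy1, hy2⟩ := mem_inter.1 hy
        have hyx : y ≠ x := fun e => hxT' (e ▸ hy2)
        have hyV : y ∉ V := fun e => disjoint_left.1 hd e hy1
        exact ⟨y, by simp [hy1, hy2, hyx, hyV]⟩
    · rw [flipTrace_of_mem_of_not_disjoint hxT hd]
      obtain ⟨y, hy, hy'⟩ := not_disjoint_iff.1 hd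
      by_cases hxT' : x ∈ T'
      · by_cases hd' : Disjoint V T'
        · rw [flipTrace_of_mem hxT' hd']
          exact ⟨y, by simp [hy, hy']⟩
        · rw [flipTrace_of_mem_of_not_disjoint hxT' hd']
          exact ⟨x, by simp [hxT, hxT']⟩
      · rw [flipTrace_of_notMem hxT' ((h.mem_or_subset hs hT').resolve_left hxT')]
        exact ⟨x, by simp [hxT]⟩
  intro B hB B' hB'
  obtain ⟨T, hT, rfl⟩ := mem_image.1 hB
  obtain ⟨T', hT', rfl⟩ := mem_image.1 hB'
  by_cases hxT : x ∈ T
  · exact main T hT T' hT' hxT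
  by_cases hxT' : x ∈ T'
  · rw [inter_comm]
    exact main T' hT' T hT hxT'
  rw [flipTrace_of_notMem hxT ((h.mem_or_subset hs hT).resolve_left hxT),
    flipTrace_of_notMem hxT' ((h.mem_or_subset hs hT').resolve_left hxT')]
  exact ⟨x, by simp⟩

end

variable {α : Type*} [Fintype α] [DecidableEq α]

lemma flipTrace_mem_thickFams {s : ℕ} {𝓑 : Finset (Finset α)} (h𝓑 : 𝓑 ∈ thickFams α s) {x : α}
    {V T₀ : Finset α} (hx : x ∉ V) (hV : 2 ≤ #V) (hs : starPairs x V ⊆ 𝓑) (hT₀ : T₀ ∈ 𝓑)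
    (hd₀ : Disjoint V T₀) :
    𝓑.image (flipTrace x V) ∈ thickFams α s ∧ starPairs x V ⊆ 𝓑.image (flipTrace x V) := by
  have hV' : V.Nonempty := card_pos.1 (by omega)
  obtain ⟨h1, h2, h3⟩ := mem_thickFams.1 h𝓑
  refine ⟨mem_thickFams.2 ⟨?_, h2.flipTrace hV' hs, ?_⟩, ?_⟩
  · rw [card_image_of_injective _ (flipTrace_involutive hx).injective, h1]
  · intro B hB
    obtain ⟨T, hT, rfl⟩ := mem_image.1 hB
    by_cases hxT : x ∈ T
    · by_cases hd : Disjoint V T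
      · rw [flipTrace_of_mem hxT hd]
        exact hV.trans (card_le_card subset_union_left)
      · rw [flipTrace_of_mem_of_not_disjoint hxT hd]
        exact h3 T hT
    · have hVT := (h2.mem_or_subset hs hT).resolve_left hxT
      rw [flipTrace_of_notMem hxT hVT, card_insert_of_notMem (by simp [hxT])]
      obtain ⟨y, hy⟩ := h2 _ hT _ hT₀
      obtain ⟨hy1, hy2⟩ := mem_inter.1 hy
      have : 0 < #(T \ V) := card_pos.2 ⟨y, mem_sdiff.2
        ⟨hy1, fun e => disjoint_left.1 hd₀ e hy2⟩⟩
      omega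
  · intro P hP
    obtain ⟨y, hy, rfl⟩ := mem_image.1 hP
    exact mem_image.2 ⟨_, hs hP, flipTrace_pair hy⟩

/-- For at least half of the pairs `(𝓑, R)`, no member of `𝓑` lies in `insert x R`. -/
lemma two_pow_mul_numContaining_le (s : ℕ) {x : α} {V : Finset α} (hx : x ∉ V) (hV : 2 ≤ #V) :
    2 ^ #(insert x V)ᶜ * numContaining s (starPairs x V) ≤
      2 * #{p ∈ {𝓑 ∈ thickFams α s | starPairs x V ⊆ 𝓑} ×ˢ ((insert x V)ᶜ).powerset |
        ∀ T ∈ p.1, ¬ T ⊆ insert x p.2} := by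
  have hV' : V.Nonempty := card_pos.1 (by omega)
  set W := (insert x V)ᶜ with hW
  set 𝓟 := {𝓑 ∈ thickFams α s | starPairs x V ⊆ 𝓑} ×ˢ W.powerset with h𝓟
  have h1 : #𝓟 = 2 ^ #W * numContaining s (starPairs x V) := by
    rw [h𝓟, card_product, card_powerset, mul_comm, numContaining]
  rw [← h1, ← card_filter_add_card_filter_not (s := 𝓟) (fun p => ∀ T ∈ p.1, ¬ T ⊆ insert x p.2),
    two_mul, add_le_add_iff_left]
  refine card_le_card_of_injOn (fun p => (p.1.image (flipTrace x V), W \ p.2)) ?_ ?_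
  · rintro ⟨𝓑, R⟩ hp
    simp only [h𝓟, coe_filter, mem_product, mem_filter, mem_powerset, not_forall, not_not,
      Set.mem_ofPred_eq] at hp ⊢
    obtain ⟨⟨⟨h2, h3⟩, hR⟩, T₀, hT₀, hT₀R⟩ := hp
    have h4 := (mem_thickFams.1 h2).2.1
    have hRV : Disjoint V R := disjoint_left.2 fun y hy hyR => by
      have := hR hyR
      simp [hW, hy] at this
    have hVR : Disjoint V (insert x R) := disjoint_insert_right.2 ⟨hx, hRV⟩
    have hd₀ : Disjoint V T₀ := hVR.mono_right hT₀R
    refine ⟨⟨flipTrace_mem_thickFams h2 hx hV h3 hT₀ hd₀, sdiff_subset⟩, ?_⟩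
    intro B hB hBR
    obtain ⟨T, hT, rfl⟩ := mem_image.1 hB
    have hVW : Disjoint V (insert x (W \ R)) := disjoint_insert_right.2 ⟨hx,
      disjoint_left.2 fun y hy hyR => by simp [hW, hy] at hyR⟩
    by_cases hxT : x ∈ T
    · by_cases hd : Disjoint V T
      · rw [flipTrace_of_mem hxT hd] at hBR
        obtain ⟨v, hv⟩ := hV'
        exact disjoint_left.1 hVW hv (hBR (by simp [hv]))
      · rw [flipTrace_of_mem_of_not_disjoint hxT hd] at hBR
        exact hd (hVW.mono_right hBR)
    · rw [flipTrace_of_notMem hxT ((h4.mem_or_subset h3 hT).resolve_left hxT)] at hBR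
      obtain ⟨y, hy⟩ := h4 _ hT _ hT₀
      obtain ⟨hy1, hy2⟩ := mem_inter.1 hy
      have hyx : y ≠ x := fun e => hxT (e ▸ hy1)
      have hyR : y ∈ R := (mem_insert.1 (hT₀R hy2)).resolve_left hyx
      have h5 := hBR (mem_insert_of_mem (mem_sdiff.2
        ⟨hy1, fun e => disjoint_left.1 hd₀ e hy2⟩))
      simp [hyx, hyR] at h5
  · rintro ⟨𝓑, R⟩ hp ⟨𝓒, R'⟩ hp' h
    simp only [h𝓟, coe_filter, mem_product, mem_powerset, Set.mem_ofPred_eq] at hp hp'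
    simp only [Prod.mk.injEq] at h ⊢
    refine ⟨image_injective (flipTrace_involutive hx).injective h.1, ?_⟩
    rw [← Finset.sdiff_sdiff_eq_self hp.1.2, h.2, Finset.sdiff_sdiff_eq_self hp'.1.2]

end

section

variable {α : Type*} [Fintype α] [DecidableEq α]

/-- Complements the members of `𝓑` below `D`, with `K` sent to `Dᶜ` if `D` is missing. -/
def reflectBelow (𝓑 : Finset (Finset α)) (K D T : Finset α) : Finset α :=
  if T ⊆ D then if T = K ∧ D ∉ 𝓑 then Dᶜ else Tᶜ else T

/-- All members of `𝓑` below `D` lie above the member `K`. -/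
structure IsAnchored (𝓑 : Finset (Finset α)) (K D : Finset α) : Prop where
  inter : IsInter 𝓑
  mem : K ∈ 𝓑
  sub : K ⊆ D
  above : ∀ T ∈ 𝓑, T ⊆ D → K ⊆ T

namespace IsAnchored

variable {𝓑 : Finset (Finset α)} {K D : Finset α}

lemma reflect_of_not_subset {T : Finset α} (hT : ¬ T ⊆ D) : reflectBelow 𝓑 K D T = T :=
  if_neg hT

lemma exists_reflect_eq (h : IsAnchored 𝓑 K D) {T : Finset α} (hT : T ∈ 𝓑) (hTD : T ⊆ D) :
    ∃ U, K ⊆ U ∧ U ⊆ D ∧ reflectBelow 𝓑 K D T = Uᶜ := by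
  by_cases hc : T = K ∧ D ∉ 𝓑
  · exact ⟨D, h.sub, Subset.rfl, by rw [reflectBelow, if_pos hTD, if_pos hc]⟩
  · exact ⟨T, h.above T hT hTD, hTD, by rw [reflectBelow, if_pos hTD, if_neg hc]⟩

/-- The images of the members below `D` are the ones that miss `K`. -/
lemma disjoint_reflect_iff (h : IsAnchored 𝓑 K D) {T : Finset α} (hT : T ∈ 𝓑) :
    Disjoint K (reflectBelow 𝓑 K D T) ↔ T ⊆ D := by
  constructor
  · intro hd
    by_contra hc
    rw [reflect_of_not_subset hc, disjoint_iff_inter_eq_empty] at hd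
    exact (h.inter _ h.mem _ hT).ne_empty hd
  · intro hTD
    obtain ⟨U, hKU, -, hU⟩ := h.exists_reflect_eq hT hTD
    rw [hU]
    exact disjoint_compl_right.mono_left hKU

lemma injOn (h : IsAnchored 𝓑 K D) : Set.InjOn (reflectBelow 𝓑 K D) 𝓑 := by
  intro T hT T' hT' he
  by_cases hTD : T ⊆ D
  · have hTD' := (h.disjoint_reflect_iff hT').1 (he ▸ (h.disjoint_reflect_iff hT).2 hTD)
    simp only [reflectBelow, if_pos hTD, if_pos hTD'] at he
    split_ifs at he with h1 h2 h2
    · rw [h1.1, h2.1]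
    · exact absurd hT' (compl_injective he ▸ h1.2)
    · exact absurd hT (compl_injective he ▸ h2.2)
    · exact compl_injective he
  · have hTD' : ¬ T' ⊆ D := fun hc =>
      hTD ((h.disjoint_reflect_iff hT).1 (he ▸ (h.disjoint_reflect_iff hT').2 hc))
    rwa [reflect_of_not_subset hTD, reflect_of_not_subset hTD'] at he

lemma compl_mem (h : IsAnchored 𝓑 K D) : Dᶜ ∈ 𝓑.image (reflectBelow 𝓑 K D) := by
  by_cases hD : D ∈ 𝓑
  · exact mem_image.2 ⟨D, hD, by simp [reflectBelow, hD]⟩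
  · exact mem_image.2 ⟨K, h.mem, by simp [reflectBelow, hD, h.sub]⟩

lemma compl_subset_of_disjoint (h : IsAnchored 𝓑 K D) {Z : Finset α}
    (hZ : Z ∈ 𝓑.image (reflectBelow 𝓑 K D)) (hd : Disjoint K Z) : Dᶜ ⊆ Z := by
  obtain ⟨T, hT, rfl⟩ := mem_image.1 hZ
  obtain ⟨U, -, hUD, hU⟩ := h.exists_reflect_eq hT ((h.disjoint_reflect_iff hT).1 hd)
  rw [hU]
  exact compl_subset_compl.2 hUD

lemma image_mem_thickFams {s : ℕ} (h : IsAnchored 𝓑 K D) (h𝓑 : 𝓑 ∈ thickFams α s)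
    (hD : 2 ≤ #Dᶜ) : 𝓑.image (reflectBelow 𝓑 K D) ∈ thickFams α s := by
  obtain ⟨h1, h2, h3⟩ := mem_thickFams.1 h𝓑
  have hne : Dᶜ.Nonempty := card_pos.1 (by omega)
  have low : ∀ T ∈ 𝓑, T ⊆ D → Dᶜ ⊆ reflectBelow 𝓑 K D T := fun T hT hTD =>
    h.compl_subset_of_disjoint (mem_image_of_mem _ hT) ((h.disjoint_reflect_iff hT).2 hTD)
  have high : ∀ T, ¬ T ⊆ D → (Dᶜ ∩ T).Nonempty := fun T hT => by
    rwa [inter_comm, ← sdiff_eq_inter_compl, sdiff_nonempty]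
  refine mem_thickFams.2 ⟨by rw [card_image_of_injOn h.injOn, h1], ?_, ?_⟩
  · intro B hB B' hB'
    obtain ⟨T, hT, rfl⟩ := mem_image.1 hB
    obtain ⟨T', hT', rfl⟩ := mem_image.1 hB'
    by_cases hTD : T ⊆ D <;> by_cases hTD' : T' ⊆ D
    · exact hne.mono (subset_inter (low T hT hTD) (low T' hT' hTD'))
    · rw [reflect_of_not_subset hTD']
      exact (high T' hTD').mono (inter_subset_inter_right (low T hT hTD))
    · rw [reflect_of_not_subset hTD, inter_comm]
      exact (high T hTD).mono (inter_subset_inter_right (low T' hT' hTD'))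
    · rw [reflect_of_not_subset hTD, reflect_of_not_subset hTD']
      exact h2 _ hT _ hT'
  · intro B hB
    obtain ⟨T, hT, rfl⟩ := mem_image.1 hB
    by_cases hTD : T ⊆ D
    · exact hD.trans (card_le_card (low T hT hTD))
    · rw [reflect_of_not_subset hTD]
      exact h3 T hT

lemma compl_mem_image_iff (h : IsAnchored 𝓑 K D) {T : Finset α} (hTD : T ⊆ D) (hKT : K ⊆ T)
    (hTne : T ≠ K) (hTne' : T ≠ D) : Tᶜ ∈ 𝓑.image (reflectBelow 𝓑 K D) ↔ T ∈ 𝓑 := by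
  constructor
  · intro hm
    obtain ⟨U, hU, he⟩ := mem_image.1 hm
    have hUD := (h.disjoint_reflect_iff hU).1 (he ▸ disjoint_compl_right.mono_left hKT)
    rw [reflectBelow, if_pos hUD] at he
    split_ifs at he with h1
    · exact absurd (compl_injective he).symm hTne'
    · exact compl_injective he ▸ hU
  · intro hT
    exact mem_image.2 ⟨T, hT, by simp [reflectBelow, hTD, hTne]⟩

lemma compl_anchor_mem_image_iff (h : IsAnchored 𝓑 K D) (hne : K ≠ D) :
    Kᶜ ∈ 𝓑.image (reflectBelow 𝓑 K D) ↔ D ∈ 𝓑 := by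
  constructor
  · intro hm
    obtain ⟨U, hU, he⟩ := mem_image.1 hm
    have hUD := (h.disjoint_reflect_iff hU).1 (he ▸ disjoint_compl_right)
    rw [reflectBelow, if_pos hUD] at he
    split_ifs at he with h1
    · exact absurd (compl_injective he).symm hne
    · by_contra hD
      exact h1 ⟨compl_injective he, hD⟩
  · intro hD
    exact mem_image.2 ⟨K, h.mem, by simp [reflectBelow, hD, h.sub]⟩

lemma subset_of_image_eq {𝓒 : Finset (Finset α)} (h : IsAnchored 𝓑 K D)
    (h' : IsAnchored 𝓒 K D)
    (he : 𝓑.image (reflectBelow 𝓑 K D) = 𝓒.image (reflectBelow 𝓒 K D)) : 𝓑 ⊆ 𝓒 := by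
  intro T hT
  by_cases hTD : T ⊆ D
  · have hKT := h.above T hT hTD
    by_cases h1 : T = K
    · exact h1 ▸ h'.mem
    by_cases h2 : T = D
    · subst h2
      exact (h'.compl_anchor_mem_image_iff (Ne.symm h1)).1
        (he ▸ (h.compl_anchor_mem_image_iff (Ne.symm h1)).2 hT)
    · exact (h'.compl_mem_image_iff hTD hKT h1 h2).1
        (he ▸ (h.compl_mem_image_iff hTD hKT h1 h2).2 hT)
  · have hm : T ∈ 𝓒.image (reflectBelow 𝓒 K D) := by
      rw [← he]
      exact mem_image.2 ⟨T, hT, reflect_of_not_subset hTD⟩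
    obtain ⟨U, hU, hUT⟩ := mem_image.1 hm
    have hUD : ¬ U ⊆ D := fun hc => hTD <| (h.disjoint_reflect_iff hT).1 (by
      rw [reflect_of_not_subset hTD, ← hUT]
      exact (h'.disjoint_reflect_iff hU).2 hc)
    rw [reflect_of_not_subset hUD] at hUT
    exact hUT ▸ hU

lemma eq_of_image_eq {𝓒 : Finset (Finset α)} {D' : Finset α} (h : IsAnchored 𝓑 K D)
    (h' : IsAnchored 𝓒 K D')
    (he : 𝓑.image (reflectBelow 𝓑 K D) = 𝓒.image (reflectBelow 𝓒 K D')) : 𝓑 = 𝓒 ∧ D = D' := by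
  have hD : D = D' := by
    refine compl_injective (Subset.antisymm ?_ ?_)
    · exact h.compl_subset_of_disjoint (he ▸ h'.compl_mem) (disjoint_compl_right.mono_left h'.sub)
    · exact h'.compl_subset_of_disjoint (he ▸ h.compl_mem) (disjoint_compl_right.mono_left h.sub)
  subst hD
  exact ⟨(h.subset_of_image_eq h' he).antisymm (h'.subset_of_image_eq h he.symm), rfl⟩

end IsAnchored

/-- Many intersecting families contain a star together with a large set outside `𝓧`. -/
lemma numContaining_star_gain (s : ℕ) {x v : α} {V : Finset α} (hx : x ∉ V) (hv : v ∈ V)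
    (hV : 2 ≤ #V) (𝓧 : Finset (Finset α)) (hX : (insert x V)ᶜ ∈ 𝓧) :
    2 ^ #(insert x V)ᶜ * numContaining s (starPairs x V) ≤
      2 * #{𝓑 ∈ thickFams α s | starPairs x (V.erase v) ⊆ 𝓑 ∧
        ∃ R ⊆ (insert x V)ᶜ, R ∉ 𝓧 ∧ (insert x (insert v R))ᶜ ∈ 𝓑} +
      2 * #𝓧 * numContaining s (starPairs x V) := by
  refine (two_pow_mul_numContaining_le s hx hV).trans ?_
  set W := (insert x V)ᶜ with hW
  set 𝓖 := {𝓑 ∈ thickFams α s | starPairs x V ⊆ 𝓑} with h𝓖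
  set 𝓟 := {p ∈ 𝓖 ×ˢ W.powerset | ∀ T ∈ p.1, ¬ T ⊆ insert x p.2} with h𝓟
  set 𝓣 := {𝓑 ∈ thickFams α s | starPairs x (V.erase v) ⊆ 𝓑 ∧
        ∃ R ⊆ W, R ∉ 𝓧 ∧ (insert x (insert v R))ᶜ ∈ 𝓑} with h𝓣
  have hVW : Disjoint V W := by
    rw [hW]; exact disjoint_compl_right.mono_left (subset_insert _ _)
  have hxW : x ∉ W := by simp [hW]
  have hvW : v ∉ W := disjoint_left.1 hVW hv
  have hxv : x ≠ v := fun h => hx (h ▸ hv)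
  have anch : ∀ p ∈ 𝓟, IsAnchored p.1 {x, v} (insert x (insert v p.2)) := by
    rintro ⟨𝓑, R⟩ hp
    simp only [h𝓟, h𝓖, mem_filter, mem_product, mem_powerset] at hp
    obtain ⟨⟨⟨h1, h2⟩, hR⟩, hgood⟩ := hp
    have h3 := (mem_thickFams.1 h1).2.1
    refine ⟨h3, h2 (mem_image_of_mem _ hv), fun z hz => ?_, fun T hT hTD => ?_⟩
    · simp only [mem_insert, mem_singleton] at hz ⊢
      tauto
    · have hvT : v ∈ T := by
        by_contra hvT
        refine hgood T hT fun z hz => ?_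
        have h4 := hTD hz
        simp only [mem_insert] at h4 ⊢
        rcases h4 with h4 | h4 | h4
        · exact Or.inl h4
        · exact absurd hz (h4 ▸ hvT)
        · exact Or.inr h4
      have hxT : x ∈ T := by
        refine (h3.mem_or_subset h2 hT).resolve_right fun hVT => ?_
        obtain ⟨y, hy⟩ := card_pos.1 (show 0 < #(V.erase v) by rw [card_erase_of_mem hv]; omega)
        obtain ⟨hyv, hy⟩ := mem_erase.1 hy
        have h4 := hTD (hVT hy)
        simp only [mem_insert] at h4
        rcases h4 with rfl | h4 | h4
        · exact hx hy
        · exact hyv h4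
        · exact disjoint_left.1 hVW hy (hR h4)
      intro z hz
      simp only [mem_insert, mem_singleton] at hz
      rcases hz with rfl | rfl <;> assumption
  have hsplit : #𝓟 ≤ #{p ∈ 𝓟 | p.2 ∉ 𝓧} + #𝓧 * #𝓖 := by
    rw [← card_filter_add_card_filter_not (s := 𝓟) (fun p => p.2 ∉ 𝓧), add_le_add_iff_left,
      mul_comm, ← card_product]
    refine card_le_card fun p hp => ?_
    simp only [h𝓟, mem_filter, mem_product, not_not] at hp ⊢
    exact ⟨hp.1.1.1, hp.2⟩
  have hle : #{p ∈ 𝓟 | p.2 ∉ 𝓧} ≤ #𝓣 := by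
    refine card_le_card_of_injOn
      (fun p => p.1.image (reflectBelow p.1 {x, v} (insert x (insert v p.2)))) ?_ ?_
    · rintro ⟨𝓑, R⟩ hp
      obtain ⟨hp, hRX⟩ := mem_filter.1 hp
      have ha := anch _ hp
      simp only [h𝓟, h𝓖, mem_filter, mem_product, mem_powerset] at hp
      obtain ⟨⟨⟨h1, h2⟩, hR⟩, hgood⟩ := hp
      have hRW : R ⊂ W := hR.ssubset_of_ne fun h => hRX (h ▸ hX)
      obtain ⟨z, hzW, hzR⟩ := exists_of_ssubset hRW
      obtain ⟨y, hy⟩ := card_pos.1 (show 0 < #(V.erase v) by rw [card_erase_of_mem hv]; omega)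
      have hdisj : ∀ y ∈ V.erase v, y ∉ insert x (insert v R) := by
        intro y hy h4
        obtain ⟨hyv, hy⟩ := mem_erase.1 hy
        simp only [mem_insert] at h4
        rcases h4 with rfl | h4 | h4
        · exact hx hy
        · exact hyv h4
        · exact disjoint_left.1 hVW hy (hR h4)
      refine mem_coe.2 (mem_filter.2 ⟨ha.image_mem_thickFams h1 ?_, ?_, R, hR, hRX, ha.compl_mem⟩)
      · refine one_lt_card.2 ⟨y, mem_compl.2 (hdisj y hy), z, ?_, ?_⟩
        · simp only [mem_compl, mem_insert, not_or]
          exact ⟨fun h => hxW (h ▸ hzW), fun h => hvW (h ▸ hzW), hzR⟩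
        · rintro rfl
          exact disjoint_left.1 hVW (mem_of_mem_erase hy) hzW
      · intro P hP
        obtain ⟨u, hu, rfl⟩ := mem_image.1 hP
        refine mem_image.2 ⟨_, h2 (mem_image_of_mem _ (mem_of_mem_erase hu)),
          IsAnchored.reflect_of_not_subset fun hc => hdisj u hu (hc ?_)⟩
        simp
    · rintro ⟨𝓑, R⟩ hp ⟨𝓒, R'⟩ hp' he
      have h1 := (mem_filter.1 hp).1
      have h2 := (mem_filter.1 hp').1
      obtain ⟨h3, h4⟩ := (anch _ h1).eq_of_image_eq (anch _ h2) he
      simp only at h3 h4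
      simp only [h𝓟, mem_filter, mem_product, mem_powerset] at h1 h2
      have hR : x ∉ R := fun h => hxW (h1.1.2 h)
      have hR' : x ∉ R' := fun h => hxW (h2.1.2 h)
      have hvR : v ∉ R := fun h => hvW (h1.1.2 h)
      have hvR' : v ∉ R' := fun h => hvW (h2.1.2 h)
      have h5 : insert v R = insert v R' := by
        rw [← erase_insert (show x ∉ insert v R by simp [hxv, hR]), h4,
          erase_insert (by simp [hxv, hR'])]
      simp only [Prod.mk.injEq]
      exact ⟨h3, by rw [← erase_insert hvR, h5, erase_insert hvR']⟩
  have h𝓖' : #𝓖 = numContaining s (starPairs x V) := rfl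
  rw [h𝓖'] at hsplit
  nlinarith

end

section

section

variable {β : Type*} [DecidableEq β]

lemma eq_pair_of_mem {T : Finset β} (hT : #T = 2) {y z : β} (hyz : y ≠ z) (hy : y ∈ T)
    (hz : z ∈ T) : T = {y, z} := by
  refine (eq_of_subset_of_card_le ?_ ?_).symm
  · simp [insert_subset_iff, hy, hz]
  · rw [hT, card_pair hyz]

/-- More than three pairwise intersecting pairs have a common point. -/
lemma exists_common_point {E : Finset (Finset β)} (hE : ∀ P ∈ E, #P = 2) (h4 : 3 < #E)
    (hI : IsInter E) : ∃ x, ∀ P ∈ E, x ∈ P := by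
  obtain ⟨P, hP, Q, hQ, hPQ⟩ := one_lt_card.1 (show 1 < #E by omega)
  obtain ⟨a, ha⟩ := hI _ hP _ hQ
  obtain ⟨haP, haQ⟩ := mem_inter.1 ha
  obtain ⟨b, hb⟩ := card_eq_one.1 (show #(P.erase a) = 1 by rw [card_erase_of_mem haP, hE P hP])
  obtain ⟨c, hc⟩ := card_eq_one.1 (show #(Q.erase a) = 1 by rw [card_erase_of_mem haQ, hE Q hQ])
  obtain rfl : P = {a, b} := by rw [← hb, insert_erase haP]
  obtain rfl : Q = {a, c} := by rw [← hc, insert_erase haQ]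
  have hbc : b ≠ c := by rintro rfl; exact hPQ rfl
  have hab : a ≠ b := by rintro rfl; simpa using hE _ hP
  have hac : a ≠ c := by rintro rfl; simpa using hE _ hQ
  refine ⟨a, fun R hR => ?_⟩
  by_contra haR
  have meet : ∀ {T : Finset β} {y z : β}, ({y, z} ∩ T).Nonempty → y ∈ T ∨ z ∈ T := by
    rintro T y z ⟨u, hu⟩
    simp only [mem_inter, mem_insert, mem_singleton] at hu
    rcases hu with ⟨rfl | rfl, hu⟩
    · exact Or.inl hu
    · exact Or.inr hu
  have hbR := (meet (hI _ hP _ hR)).resolve_left haR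
  have hcR := (meet (hI _ hQ _ hR)).resolve_left haR
  have hR' := eq_pair_of_mem (hE R hR) hbc hbR hcR
  subst hR'
  have : #E ≤ #({{a, b}, {a, c}, {b, c}} : Finset (Finset β)) := by
    refine card_le_card fun T hT => ?_
    have h1 := meet (hI _ hP _ hT)
    have h2 := meet (hI _ hQ _ hT)
    have h3 := meet (hI _ hR _ hT)
    simp only [mem_insert, mem_singleton]
    by_cases haT : a ∈ T
    · rcases h3 with h | h
      · exact Or.inl (eq_pair_of_mem (hE T hT) hab haT h)
      · exact Or.inr (Or.inl (eq_pair_of_mem (hE T hT) hac haT h))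
    · exact Or.inr (Or.inr (eq_pair_of_mem (hE T hT) hbc (h1.resolve_left haT)
        (h2.resolve_left haT)))
  exact absurd (this.trans card_le_three) (by omega)

end

variable {α : Type*} [Fintype α] [DecidableEq α]

lemma sum_choose_card_inter (s k : ℕ) (E : Finset (Finset α)) :
    ∑ 𝓑 ∈ thickFams α s, (#(𝓑 ∩ E)).choose k = ∑ 𝓓 ∈ E.powersetCard k, numContaining s 𝓓 := by
  have h := sum_card_bipartiteAbove_eq_sum_card_bipartiteBelow
    (s := thickFams α s) (t := E.powersetCard k) (fun 𝓑 𝓓 => 𝓓 ⊆ 𝓑)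
  simp only [bipartiteAbove, bipartiteBelow] at h
  rw [show (∑ 𝓓 ∈ E.powersetCard k, numContaining s 𝓓) = _ from h.symm]
  refine sum_congr rfl fun 𝓑 _ => ?_
  rw [← card_powersetCard]
  congr 1
  ext 𝓓
  simp only [mem_powersetCard, mem_filter, subset_inter_iff]
  tauto

lemma sum_numContaining_pairs (s : ℕ) {E : Finset (Finset α)} (hE : ∀ P ∈ E, #P = 2) :
    ∑ 𝓓 ∈ E.powersetCard 1, numContaining s 𝓓 = #E * starNum α s 1 := by
  rw [powersetCard_one, sum_map, ← smul_eq_mul, ← sum_const]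
  exact sum_congr rfl fun P hP => numContaining_pair s (hE P hP)

lemma le_one_add_choose_two (h : ℕ) : h ≤ (if h = 0 then 0 else 1) + h.choose 2 := by
  induction h with
  | zero => simp
  | succ h ih =>
    rw [Nat.choose_succ_succ' h 1, Nat.choose_one_right]
    split_ifs at ih <;> simp <;> omega

lemma one_add_choose_two_le (h : ℕ) :
    (if h = 0 then 0 else 1) + h.choose 2 ≤ h + h.choose 3 := by
  induction h with
  | zero => simp
  | succ h ih =>
    have := le_one_add_choose_two h
    rw [Nat.choose_succ_succ' h 1, Nat.choose_succ_succ' h 2, Nat.choose_one_right]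
    split_ifs at this ih <;> simp <;> omega

lemma card_not_disjoint (s : ℕ) (E : Finset (Finset α)) :
    #{𝓑 ∈ thickFams α s | ¬ Disjoint 𝓑 E} =
      ∑ 𝓑 ∈ thickFams α s, if #(𝓑 ∩ E) = 0 then 0 else 1 := by
  rw [card_filter]
  refine sum_congr rfl fun 𝓑 _ => ?_
  simp only [card_eq_zero, ← disjoint_iff_inter_eq_empty, ite_not]

lemma mul_starNum_one_le (s : ℕ) {E : Finset (Finset α)} (hE : ∀ P ∈ E, #P = 2) :
    #E * starNum α s 1 ≤ #{𝓑 ∈ thickFams α s | ¬ Disjoint 𝓑 E} +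
      ∑ 𝓓 ∈ E.powersetCard 2, numContaining s 𝓓 := by
  rw [← sum_numContaining_pairs s hE, ← sum_choose_card_inter, ← sum_choose_card_inter,
    card_not_disjoint, ← sum_add_distrib]
  exact sum_le_sum fun 𝓑 _ => by
    rw [Nat.choose_one_right]; exact le_one_add_choose_two _

lemma card_not_disjoint_add_le (s : ℕ) {E : Finset (Finset α)} (hE : ∀ P ∈ E, #P = 2) :
    #{𝓑 ∈ thickFams α s | ¬ Disjoint 𝓑 E} + ∑ 𝓓 ∈ E.powersetCard 2, numContaining s 𝓓 ≤
      #E * starNum α s 1 + ∑ 𝓓 ∈ E.powersetCard 3, numContaining s 𝓓 := by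
  rw [← sum_numContaining_pairs s hE, ← sum_choose_card_inter, ← sum_choose_card_inter,
    ← sum_choose_card_inter, card_not_disjoint, ← sum_add_distrib, ← sum_add_distrib]
  exact sum_le_sum fun 𝓑 _ => by
    rw [Nat.choose_one_right]; exact one_add_choose_two_le _

lemma sum_numContaining_star (s k : ℕ) {x : α} {S : Finset α} (hx : x ∉ S) :
    ∑ 𝓓 ∈ (starPairs x S).powersetCard k, numContaining s 𝓓 =
      (#S).choose k * starNum α s k := by
  have hinj := pair_right_injective x
  have hc : #(starPairs x S) = #S := card_image_of_injective _ hinj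
  rw [← hc, ← card_powersetCard, ← smul_eq_mul, ← sum_const]
  refine sum_congr rfl fun 𝓓 h𝓓 => ?_
  obtain ⟨h1, h2⟩ := mem_powersetCard.1 h𝓓
  obtain ⟨T, hT, rfl⟩ := subset_image_iff.1 h1
  rw [card_image_of_injective _ hinj] at h2
  rw [← h2]
  exact numContaining_starPairs s fun h => hx (hT h)

/-- A non-intersecting set of pairs has a vanishing term in its second-order sum. -/
lemma sum_numContaining_two_add_le (s : ℕ) {E : Finset (Finset α)} (hE : ∀ P ∈ E, #P = 2)
    (hI : ¬ IsInter E) :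
    ∑ 𝓓 ∈ E.powersetCard 2, numContaining s 𝓓 + starNum α s 2 ≤
      (#E).choose 2 * starNum α s 2 := by
  simp only [IsInter, not_forall] at hI
  obtain ⟨P, hP, Q, hQ, hPQ⟩ := hI
  have hne : P ≠ Q := by
    rintro rfl
    rw [inter_self] at hPQ
    exact hPQ (card_pos.1 (by rw [hE P hP]; norm_num))
  have hmem : {P, Q} ∈ E.powersetCard 2 :=
    mem_powersetCard.2 ⟨by simp [insert_subset_iff, hP, hQ], card_pair hne⟩
  have h0 : numContaining s {P, Q} = 0 := by
    refine card_eq_zero.2 (filter_eq_empty_iff.2 fun 𝓑 h𝓑 h => hPQ ?_)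
    exact (mem_thickFams.1 h𝓑).2.1 _ (h (by simp)) _ (h (by simp))
  rw [← add_sum_erase _ _ hmem, h0, zero_add, ← card_powersetCard,
    ← card_erase_add_one hmem, add_mul, one_mul]
  refine Nat.add_le_add_right ?_ _
  rw [← smul_eq_mul]
  refine sum_le_card_nsmul _ _ _ fun 𝓓 h𝓓 => ?_
  obtain ⟨h1, h2⟩ := mem_powersetCard.1 (mem_of_mem_erase h𝓓)
  obtain ⟨P', Q', hne', rfl⟩ := card_eq_two.1 h2
  exact numContaining_two_le s (hE _ (h1 (by simp))) (hE _ (h1 (by simp))) hne'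

lemma countAvoiding_add_card (s : ℕ) {𝓛 E : Finset (Finset α)}
    (hE : ∀ T, T ∈ 𝓛 ↔ #T ≤ 1 ∨ T ∈ E) :
    countAvoiding s 𝓛 + #{𝓑 ∈ thickFams α s | ¬ Disjoint 𝓑 E} = #(thickFams α s) := by
  rw [← card_filter_add_card_filter_not (s := thickFams α s) (fun 𝓑 => Disjoint 𝓑 E),
    countAvoiding]
  congr 2
  ext 𝓑
  simp only [thickFams, mem_filter, and_assoc, and_congr_right_iff]
  intro _
  constructor
  · intro h
    refine ⟨fun T hT => ?_, disjoint_left.2 fun T hT hTE =>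
      disjoint_left.1 h hT ((hE T).2 (Or.inr hTE))⟩
    by_contra hc
    exact disjoint_left.1 h hT ((hE T).2 (Or.inl (by omega)))
  · rintro ⟨h1, h2⟩
    refine disjoint_left.2 fun T hT hTL => ?_
    rcases (hE T).1 hTL with h | h
    · exact absurd (h1 T hT) (by omega)
    · exact disjoint_left.1 h2 hT h

lemma mem_starPairs_compl {x : α} {T : Finset α} :
    T ∈ starPairs x {x}ᶜ ↔ #T = 2 ∧ x ∈ T := by
  simp only [starPairs, mem_image, mem_compl, mem_singleton]
  constructor
  · rintro ⟨y, hy, rfl⟩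
    exact ⟨card_pair (Ne.symm hy), by simp⟩
  · rintro ⟨h, hx⟩
    obtain ⟨y, hy⟩ := card_eq_one.1 (show #(T.erase x) = 1 by rw [card_erase_of_mem hx, h])
    have : y ∈ T.erase x := by simp [hy]
    exact ⟨y, (mem_erase.1 this).1, by rw [← hy, insert_erase hx]⟩

lemma mem_starComplement_iff {x : α} {T : Finset α} :
    T ∈ starComplement x ↔ #T ≤ 1 ∨ T ∈ starPairs x {x}ᶜ := by
  simp [starComplement, mem_starPairs_compl]

lemma card_starPairs_compl (x : α) : #(starPairs x {x}ᶜ) = Fintype.card α - 1 := by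
  rw [starPairs, card_image_of_injective _ (pair_right_injective x), card_compl, card_singleton]

lemma card_of_mem_iff {𝓛 E : Finset (Finset α)} (hE : ∀ T, T ∈ 𝓛 ↔ #T ≤ 1 ∨ T ∈ E)
    (hE2 : ∀ P ∈ E, #P = 2) : #𝓛 = Fintype.card α + 1 + #E := by
  rw [← card_filter_card_le_one, ← card_union_of_disjoint]
  · congr 1; ext T; simp [hE]
  · exact disjoint_left.2 fun T hT hTE => by
      have := hE2 T hTE
      simp at hT; omega

lemma card_starComplement (x : α) : #(starComplement x) = 2 * Fintype.card α := by
  rw [card_of_mem_iff (fun T => mem_starComplement_iff) (fun P hP => (mem_starPairs_compl.1 hP).1),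
    card_starPairs_compl]
  have : 0 < Fintype.card α := Fintype.card_pos_iff.2 ⟨x⟩
  omega

lemma starNum_three_le {s : ℕ} (hn : 4 ≤ Fintype.card α) :
    2 ^ (Fintype.card α - 4) * starNum α s 3 ≤ 2 * starNum α s 2 + 2 * starNum α s 3 := by
  obtain ⟨U, -, hU⟩ := exists_subset_card_eq (s := (univ : Finset α)) (n := 4)
    (by rw [card_univ]; omega)
  obtain ⟨x, hx⟩ := card_pos.1 (show 0 < #U by omega)
  have hV : #(U.erase x) = 3 := by rw [card_erase_of_mem hx, hU]
  obtain ⟨v, hv⟩ := card_pos.1 (show 0 < #(U.erase x) by omega)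
  have h := numContaining_star_gain s (notMem_erase x U) hv (by omega) {(insert x (U.erase x))ᶜ}
    (by simp)
  rw [numContaining_starPairs s (notMem_erase x U), hV, insert_erase hx, card_compl, hU,
    card_singleton] at h
  refine h.trans (Nat.add_le_add (Nat.mul_le_mul_left _ ?_) (by omega))
  have h2 : #((U.erase x).erase v) = 2 := by rw [card_erase_of_mem hv, hV]
  rw [← h2, ← numContaining_starPairs s (x := x) (by simp)]
  exact card_le_card fun 𝓑 h𝓑 => by
    simp only [mem_filter] at h𝓑 ⊢
    exact ⟨h𝓑.1, h𝓑.2.1⟩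

lemma two_mul_choose_three_lt {n : ℕ} (hn : 21 ≤ n) :
    2 * (n - 1).choose 3 + 2 < 2 ^ (n - 4) := by
  obtain ⟨k, rfl⟩ : ∃ k, n = k + 4 := ⟨n - 4, by omega⟩
  have h2 : 2 * (k + 3) ^ 3 + 2 < 2 ^ k := by
    have hk : 17 ≤ k := by omega
    clear hn
    induction k, hk using Nat.le_induction with
    | base => norm_num
    | succ k hk ih =>
      obtain ⟨j, rfl⟩ := Nat.exists_eq_add_of_le hk
      have h4 : (17 + j + 1 + 3) ^ 3 + (j ^ 3 + 57 * j ^ 2 + 1077 * j + 6739) =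
          2 * (17 + j + 3) ^ 3 := by ring
      rw [pow_succ 2 (17 + j)]
      omega
  have h3 : (k + 3).choose 3 ≤ (k + 3) ^ 3 := Nat.choose_le_pow _ _
  simp only [Nat.add_sub_cancel, show k + 4 - 1 = k + 3 by omega]
  omega

/-- An optimal family consisting of all sets of size at most one and some pairs is a star
complement. -/
lemma IsBest.eq_starComplement {s : ℕ} (hs1 : 2 ≤ s) (hs2 : s ≤ 2 ^ (Fintype.card α - 1))
    (hn : 21 ≤ Fintype.card α) {𝓛 : Finset (Finset α)} (hbest : IsBest s 𝓛)
    (hcard : #𝓛 = 2 * Fintype.card α) (hle : ∀ L ∈ 𝓛, #L ≤ 2)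
    (hmem : ∀ T : Finset α, #T ≤ 1 → T ∈ 𝓛) : ∃ x, 𝓛 = starComplement x := by
  set E := {T ∈ 𝓛 | #T = 2} with hEdef
  have hE2 : ∀ P ∈ E, #P = 2 := fun P hP => (mem_filter.1 hP).2
  have hE : ∀ T, T ∈ 𝓛 ↔ #T ≤ 1 ∨ T ∈ E := by
    intro T
    simp only [hEdef, mem_filter]
    constructor
    · intro h
      have := hle T h
      by_cases h1 : #T ≤ 1
      · exact Or.inl h1
      · exact Or.inr ⟨h, by omega⟩
    · rintro (h | h)
      · exact hmem T h
      · exact h.1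
  have hEc : #E = Fintype.card α - 1 := by
    have := card_of_mem_iff hE hE2
    omega
  by_cases hI : IsInter E
  · obtain ⟨x, hx⟩ := exists_common_point hE2 (by omega) hI
    have hsub : E = starPairs x {x}ᶜ := eq_of_subset_of_card_le
      (fun P hP => mem_starPairs_compl.2 ⟨hE2 P hP, hx P hP⟩)
      (by rw [card_starPairs_compl, hEc])
    exact ⟨x, by ext T; rw [hE, mem_starComplement_iff, hsub]⟩
  · exfalso
    obtain ⟨x⟩ : Nonempty α := Fintype.card_pos_iff.1 (by omega)
    have h1 := hbest (starComplement x) (by rw [hcard, card_starComplement])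
    have h2 := countAvoiding_add_card s hE
    have h3 := countAvoiding_add_card s (fun T => mem_starComplement_iff (x := x) (T := T))
    have h4 := mul_starNum_one_le s hE2
    have h5 := sum_numContaining_two_add_le s hE2 hI
    have h6 := card_not_disjoint_add_le s (E := starPairs x {x}ᶜ)
      (fun P hP => (mem_starPairs_compl.1 hP).1)
    have hx : x ∉ ({x}ᶜ : Finset α) := by simp
    rw [sum_numContaining_star s 2 hx, sum_numContaining_star s 3 hx, card_starPairs_compl,
      card_compl, card_singleton] at h6
    rw [hEc] at h4 h5
    have h7 : starNum α s 2 ≤ (Fintype.card α - 1).choose 3 * starNum α s 3 := by omega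
    have h8 := starNum_three_le (α := α) (s := s) (by omega)
    have h9 := starNum_two_pos (α := α) hs1 hs2 (by omega)
    have h10 := two_mul_choose_three_lt hn
    have h11 : 0 < starNum α s 3 := by
      by_contra hc
      have : starNum α s 3 = 0 := by omega
      rw [this] at h7
      omega
    nlinarith

end

section

variable {α : Type*} [Fintype α]

/-- The requirements under which `recode` is reversible. -/
structure RecodeData (Q A : Finset α) (𝓝 : Finset (Finset α)) (G : Finset α → Finset α) :
    Prop where
  card_pair : #Q = 2
  pair_subset : Q ⊆ A
  three_le : 3 ≤ #A
  card_le : 2 * #A + 2 ≤ Fintype.card α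
  notMem : A ∉ 𝓝
  three_le_of_mem : ∀ L ∈ 𝓝, 3 ≤ #L
  card_le_of_mem : ∀ L ∈ 𝓝, 2 * #L + 2 ≤ Fintype.card α
  down : ∀ L ∈ 𝓝, ∀ T ⊆ L, 3 ≤ #T → T ∈ 𝓝
  injOn : Set.InjOn G 𝓝
  card_code : ∀ L ∈ 𝓝, #(G L) = 3
  subset_code : ∀ L ∈ 𝓝, Q ⊆ G L
  code_notMem : ∀ L ∈ 𝓝, G L ∉ 𝓝
  code_ne : ∀ L ∈ 𝓝, G L ≠ A

namespace RecodeData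

variable {Q A : Finset α} {𝓝 : Finset (Finset α)} {G : Finset α → Finset α}

/-- The sets whose complements may appear are small. -/
lemma card_le_of_removed (h : RecodeData Q A 𝓝 G) {M : Finset α}
    (hM : M = Q ∨ M ∈ 𝓝 ∨ ∃ L ∈ 𝓝, M = G L) : 2 * #M + 2 ≤ Fintype.card α := by
  have h1 := h.card_le
  have h2 := h.three_le
  rcases hM with rfl | hM | ⟨L, hL, rfl⟩
  · have := h.card_pair; omega
  · exact h.card_le_of_mem M hM
  · have := h.card_code L hL; omega

lemma pair_notMem (h : RecodeData Q A 𝓝 G) : Q ∉ 𝓝 := fun hc => by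
  have := h.three_le_of_mem Q hc
  have := h.card_pair
  omega

lemma pair_ne_code (h : RecodeData Q A 𝓝 G) {L : Finset α} (hL : L ∈ 𝓝) : Q ≠ G L := fun hc => by
  have := h.card_code L hL
  have := h.card_pair
  simp_all

end RecodeData

variable [DecidableEq α]

/-- The intersecting families of size `s` containing `Q` and otherwise only sets of size at least
three. -/
def pureFams (s : ℕ) (Q : Finset α) : Finset (Finset (Finset α)) :=
  {𝓑 ∈ thickFams α s | Q ∈ 𝓑 ∧ ∀ T ∈ 𝓑, #T = 2 → T = Q}

/-- Trades the pair `Q` for `A` and frees `𝓑` of the members in `𝓝`, the triples `G L` recording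
which of them were present. -/
def recode (Q A : Finset α) (𝓝 : Finset (Finset α)) (G : Finset α → Finset α)
    (𝓑 : Finset (Finset α)) (T : Finset α) : Finset α :=
  if T = Q then if A ∈ 𝓑 then Qᶜ else A
  else if T ∈ 𝓝 then if G T ∈ 𝓑 then Tᶜ else (G T)ᶜ
  else if T ∈ (𝓝 ∩ 𝓑).image G then Tᶜ else T

namespace RecodeData

variable {Q A : Finset α} {𝓝 : Finset (Finset α)} {G : Finset α → Finset α}
  {𝓑 : Finset (Finset α)} {s : ℕ}

/-- A value of `recode` is an unchanged set, the set `A`, or the complement of a small set. -/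
lemma recode_cases (T : Finset α) (𝓑 : Finset (Finset α)) :
    (recode Q A 𝓝 G 𝓑 T = T ∧ T ≠ Q ∧ T ∉ 𝓝 ∧ ∀ L ∈ 𝓝, L ∈ 𝓑 → G L ≠ T) ∨
    (T = Q ∧ A ∉ 𝓑 ∧ recode Q A 𝓝 G 𝓑 T = A) ∨
    (T = Q ∧ A ∈ 𝓑 ∧ recode Q A 𝓝 G 𝓑 T = Qᶜ) ∨
    (T ≠ Q ∧ T ∈ 𝓝 ∧ G T ∈ 𝓑 ∧ recode Q A 𝓝 G 𝓑 T = Tᶜ) ∨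
    (T ≠ Q ∧ T ∈ 𝓝 ∧ G T ∉ 𝓑 ∧ recode Q A 𝓝 G 𝓑 T = (G T)ᶜ) ∨
    (T ∉ 𝓝 ∧ ∃ L ∈ 𝓝, L ∈ 𝓑 ∧ G L = T ∧ recode Q A 𝓝 G 𝓑 T = Tᶜ) := by
  unfold recode
  by_cases h1 : T = Q
  · by_cases h2 : A ∈ 𝓑 <;> simp [h1, h2]
  by_cases h2 : T ∈ 𝓝
  · by_cases h3 : G T ∈ 𝓑 <;> simp [h1, h2, h3]
  by_cases h3 : T ∈ (𝓝 ∩ 𝓑).image G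
  · have h4 := h3
    simp only [mem_image, mem_inter] at h4
    obtain ⟨L, ⟨h5, h6⟩, h7⟩ := h4
    simp only [if_neg h1, if_neg h2, if_pos h3]
    exact Or.inr (Or.inr (Or.inr (Or.inr (Or.inr ⟨h2, L, h5, h6, h7, trivial⟩))))
  · simp only [if_neg h1, if_neg h2, if_neg h3]
    simp only [mem_image, mem_inter, not_exists, not_and] at h3
    exact Or.inl ⟨trivial, h1, h2, fun L hL hB => h3 L ⟨hL, hB⟩⟩

lemma mem_pureFams : 𝓑 ∈ pureFams s Q ↔
    (#𝓑 = s ∧ IsInter 𝓑 ∧ ∀ T ∈ 𝓑, 2 ≤ #T) ∧ Q ∈ 𝓑 ∧ ∀ T ∈ 𝓑, #T = 2 → T = Q := by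
  rw [pureFams, mem_filter, mem_thickFams]

lemma three_le_of_pure (h𝓑 : 𝓑 ∈ pureFams s Q) {T : Finset α} (hT : T ∈ 𝓑) (hne : T ≠ Q) :
    3 ≤ #T := by
  obtain ⟨⟨-, -, h1⟩, -, h2⟩ := mem_pureFams.1 h𝓑
  have := h1 T hT
  by_contra hc
  exact hne (h2 T hT (by omega))

lemma meets_of_pure (h𝓑 : 𝓑 ∈ pureFams s Q) {T : Finset α} (hT : T ∈ 𝓑) : ¬ Disjoint Q T := by
  obtain ⟨⟨-, h1, -⟩, h2, -⟩ := mem_pureFams.1 h𝓑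
  rw [not_disjoint_iff_nonempty_inter]
  exact h1 _ h2 _ hT

lemma mem_image_recode (h : RecodeData Q A 𝓝 G) (h𝓑 : 𝓑 ∈ pureFams s Q) {Z : Finset α} :
    Z ∈ 𝓑.image (recode Q A 𝓝 G 𝓑) ↔
      (Z ∈ 𝓑 ∧ Z ≠ Q ∧ Z ∉ 𝓝 ∧ ∀ L ∈ 𝓝, L ∈ 𝓑 → G L ≠ Z) ∨ Z = A ∨ (A ∈ 𝓑 ∧ Z = Qᶜ) ∨
      (∃ L ∈ 𝓝, L ∈ 𝓑 ∧ Z = (G L)ᶜ) ∨ ∃ L ∈ 𝓝, L ∈ 𝓑 ∧ G L ∈ 𝓑 ∧ Z = Lᶜ := by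
  have hQB := (mem_pureFams.1 h𝓑).2.1
  have hQN := h.pair_notMem
  rw [mem_image]
  constructor
  · rintro ⟨T, hT, rfl⟩
    rcases recode_cases (Q := Q) (A := A) (𝓝 := 𝓝) (G := G) T 𝓑 with
      ⟨h1, h2⟩ | ⟨-, -, h3⟩ | ⟨-, h2, h3⟩ | ⟨-, h2, h3, h4⟩ | ⟨-, h2, -, h4⟩ | ⟨-, L, h2, h3, h4, h5⟩
    · rw [h1]; exact Or.inl ⟨hT, h2⟩
    · exact Or.inr (Or.inl h3)
    · exact Or.inr (Or.inr (Or.inl ⟨h2, h3⟩))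
    · exact Or.inr (Or.inr (Or.inr (Or.inr ⟨T, h2, hT, h3, h4⟩)))
    · exact Or.inr (Or.inr (Or.inr (Or.inl ⟨T, h2, hT, h4⟩)))
    · exact Or.inr (Or.inr (Or.inr (Or.inl ⟨L, h2, h3, by rw [h5, h4]⟩)))
  · have hAQ : A ≠ Q := fun hc => by
      have := h.three_le; have := h.card_pair; simp_all
    rintro (⟨h1, h2, h3, h4⟩ | rfl | ⟨h1, rfl⟩ | ⟨L, h1, h2, rfl⟩ | ⟨L, h1, h2, h3, rfl⟩)
    · refine ⟨Z, h1, ?_⟩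
      rw [recode, if_neg h2, if_neg h3, if_neg]
      simp only [mem_image, mem_inter, not_exists, not_and]
      exact fun L hL => h4 L hL.1 hL.2
    · by_cases hA : Z ∈ 𝓑
      · refine ⟨Z, hA, ?_⟩
        rw [recode, if_neg hAQ, if_neg h.notMem, if_neg]
        simp only [mem_image, mem_inter, not_exists, not_and]
        exact fun L hL => h.code_ne L hL.1
      · exact ⟨Q, hQB, by rw [recode, if_pos rfl, if_neg hA]⟩
    · exact ⟨Q, hQB, by rw [recode, if_pos rfl, if_pos h1]⟩
    · by_cases hG : G L ∈ 𝓑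
      · refine ⟨G L, hG, ?_⟩
        rw [recode, if_neg (h.pair_ne_code h1).symm, if_neg (h.code_notMem L h1), if_pos]
        exact mem_image_of_mem _ (mem_inter.2 ⟨h1, h2⟩)
      · refine ⟨L, h2, ?_⟩
        rw [recode, if_neg (fun hc : L = Q => hQN (hc ▸ h1)), if_pos h1, if_neg hG]
    · refine ⟨L, h2, ?_⟩
      rw [recode, if_neg (fun hc : L = Q => hQN (hc ▸ h1)), if_pos h1, if_pos h3]

lemma compl_card_lt (h : RecodeData Q A 𝓝 G) {M : Finset α}
    (hM : M = Q ∨ M ∈ 𝓝 ∨ ∃ L ∈ 𝓝, M = G L) : Fintype.card α < 2 * #Mᶜ := by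
  have := h.card_le_of_removed hM
  rw [card_compl]
  omega

lemma ne_compl (h : RecodeData Q A 𝓝 G) {M : Finset α}
    (hM : M = Q ∨ M ∈ 𝓝 ∨ ∃ L ∈ 𝓝, M = G L) : A ≠ Mᶜ := fun hc => by
  have := h.compl_card_lt hM
  have := h.card_le
  simp_all
  omega

/-- The case analysis behind the injectivity of `recode`, with complementation abstracted. -/
lemma eq_of_cases {τ : Type*} {B N : τ → Prop} {c G : τ → τ} {Q A T T' v : τ}
    (hQG : ∀ L, N L → Q ≠ G L)
    (hinj : ∀ L, N L → ∀ L', N L' → G L = G L' → L = L') (hc : ∀ M, B M → ¬ B (c M))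
    (hA1 : A ≠ c Q) (hA2 : ∀ L, N L → A ≠ c L) (hA3 : ∀ L, N L → A ≠ c (G L))
    (hd2 : ∀ T, B T → ∀ L, N L → T ≠ c (G L))
    (hci : ∀ M M', c M = c M' → M = M') (hT : B T) (hT' : B T')
    (h1 : (v = T ∧ T ≠ Q ∧ ¬ N T ∧ ∀ L, N L → B L → G L ≠ T) ∨ (T = Q ∧ ¬ B A ∧ v = A) ∨
      (T = Q ∧ B A ∧ v = c Q) ∨ (T ≠ Q ∧ N T ∧ B (G T) ∧ v = c T) ∨
      (T ≠ Q ∧ N T ∧ ¬ B (G T) ∧ v = c (G T)) ∨ (¬ N T ∧ ∃ L, N L ∧ B L ∧ G L = T ∧ v = c T))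
    (h2 : (v = T' ∧ T' ≠ Q ∧ ¬ N T' ∧ ∀ L, N L → B L → G L ≠ T') ∨ (T' = Q ∧ ¬ B A ∧ v = A) ∨
      (T' = Q ∧ B A ∧ v = c Q) ∨ (T' ≠ Q ∧ N T' ∧ B (G T') ∧ v = c T') ∨
      (T' ≠ Q ∧ N T' ∧ ¬ B (G T') ∧ v = c (G T')) ∨
      (¬ N T' ∧ ∃ L, N L ∧ B L ∧ G L = T' ∧ v = c T')) : T = T' := by
  have := hc T hT
  have := hc T' hT'
  rcases h1 with h1 | h1 | h1 | h1 | h1 | h1 <;> rcases h2 with h2 | h2 | h2 | h2 | h2 | h2 <;>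
    first
    | (obtain ⟨-, L, hL, -, rfl, hv⟩ := h2; exact absurd (h1.2.2.symm.trans hv) (hA3 L hL))
    | (obtain ⟨-, L, hL, -, rfl, hv⟩ := h1; exact absurd (h2.2.2.symm.trans hv) (hA3 L hL))
    | grind

lemma injOn_recode (h : RecodeData Q A 𝓝 G) (h𝓑 : 𝓑 ∈ pureFams s Q) :
    Set.InjOn (recode Q A 𝓝 G 𝓑) 𝓑 := by
  have hQN := h.pair_notMem
  have hQG : ∀ L ∈ 𝓝, Q ≠ G L := fun L hL => h.pair_ne_code hL
  have hGN := h.code_notMem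
  have hinj := h.injOn
  have hI := (mem_pureFams.1 h𝓑).1.2.1
  have hc : ∀ M ∈ 𝓑, Mᶜ ∉ 𝓑 := fun M hM => hI.compl_notMem hM
  have hA1 : A ≠ Qᶜ := h.ne_compl (Or.inl rfl)
  have hA2 : ∀ L ∈ 𝓝, A ≠ Lᶜ := fun L hL => h.ne_compl (Or.inr (Or.inl hL))
  have hA3 : ∀ L ∈ 𝓝, A ≠ (G L)ᶜ := fun L hL => h.ne_compl (Or.inr (Or.inr ⟨L, hL, rfl⟩))
  have hd : ∀ T ∈ 𝓑, ∀ M, Q ⊆ M → T ≠ Mᶜ := fun T hT M hM he =>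
    meets_of_pure h𝓑 hT (he ▸ disjoint_compl_right.mono_left hM)
  have hd1 : ∀ T ∈ 𝓑, T ≠ Qᶜ := fun T hT => hd T hT Q Subset.rfl
  have hd2 : ∀ T ∈ 𝓑, ∀ L ∈ 𝓝, T ≠ (G L)ᶜ := fun T hT L hL => hd T hT _ (h.subset_code L hL)
  have hci : ∀ M M' : Finset α, Mᶜ = M'ᶜ → M = M' := fun _ _ he => compl_injective he
  have hinj' : ∀ L ∈ 𝓝, ∀ L' ∈ 𝓝, G L = G L' → L = L' := fun L hL L' hL' => hinj hL hL'
  intro T hT T' hT' he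
  exact eq_of_cases (B := (· ∈ 𝓑)) (N := (· ∈ 𝓝)) (c := compl) (G := G) hQG hinj' hc hA1
    hA2 hA3 hd2 hci hT hT' (recode_cases T 𝓑) (he ▸ recode_cases T' 𝓑)

/-- The image of a pure family under recoding avoids `𝓝` and contains `A`. -/
lemma image_recode_spec (h : RecodeData Q A 𝓝 G) (h𝓑 : 𝓑 ∈ pureFams s Q) :
    𝓑.image (recode Q A 𝓝 G 𝓑) ∈ interOfSize α s ∧ A ∈ 𝓑.image (recode Q A 𝓝 G 𝓑) ∧
      ∀ T ∈ 𝓑.image (recode Q A 𝓝 G 𝓑), 3 ≤ #T ∧ T ∉ 𝓝 := by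
  obtain ⟨⟨h1, hI, -⟩, hQB, -⟩ := mem_pureFams.1 h𝓑
  have hkept : ∀ Z ∈ 𝓑.image (recode Q A 𝓝 G 𝓑),
      (3 ≤ #Z ∧ Z ∉ 𝓝 ∧ (Z ∈ 𝓑 ∨ Z = A) ∧ ∀ L ∈ 𝓝, L ∈ 𝓑 → G L ≠ Z) ∨
      ∃ M, Z = Mᶜ ∧ (M = Q ∨ M ∈ 𝓝 ∨ ∃ L ∈ 𝓝, L ∈ 𝓑 ∧ M = G L) := by
    intro Z hZ
    rcases (h.mem_image_recode h𝓑).1 hZ with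
      ⟨h2, h3, h4, h5⟩ | rfl | ⟨-, h3⟩ | ⟨L, h2, h3, h4⟩ | ⟨L, h2, -, -, h4⟩
    · exact Or.inl ⟨three_le_of_pure h𝓑 h2 h3, h4, Or.inl h2, h5⟩
    · exact Or.inl ⟨h.three_le, h.notMem, Or.inr rfl, fun L hL _ => h.code_ne L hL⟩
    · exact Or.inr ⟨Q, h3, Or.inl rfl⟩
    · exact Or.inr ⟨G L, h4, Or.inr (Or.inr ⟨L, h2, h3, rfl⟩)⟩
    · exact Or.inr ⟨L, h4, Or.inr (Or.inl h2)⟩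
  have hweak : ∀ M, (M = Q ∨ M ∈ 𝓝 ∨ ∃ L ∈ 𝓝, L ∈ 𝓑 ∧ M = G L) →
      (M = Q ∨ M ∈ 𝓝 ∨ ∃ L ∈ 𝓝, M = G L) := by
    rintro M (hM | hM | ⟨L, hL, -, hM⟩)
    · exact Or.inl hM
    · exact Or.inr (Or.inl hM)
    · exact Or.inr (Or.inr ⟨L, hL, hM⟩)
  have hmix : ∀ Z M, 3 ≤ #Z → Z ∉ 𝓝 → (∀ L ∈ 𝓝, L ∈ 𝓑 → G L ≠ Z) →
      (M = Q ∨ M ∈ 𝓝 ∨ ∃ L ∈ 𝓝, L ∈ 𝓑 ∧ M = G L) → (Z ∩ Mᶜ).Nonempty := by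
    intro Z M h3 hZN hZG hM
    rw [← sdiff_eq_inter_compl, sdiff_nonempty]
    intro hZM
    rcases hM with rfl | hM | ⟨L, hL, hLB, rfl⟩
    · have := card_le_card hZM
      have := h.card_pair
      omega
    · exact hZN (h.down M hM Z hZM h3)
    · refine hZG L hL hLB (eq_of_subset_of_card_le hZM ?_).symm
      rw [h.card_code L hL]
      exact h3
  have hmeetA : ∀ T ∈ 𝓑, (T ∩ A).Nonempty := fun T hT =>
    (hI _ hT _ hQB).mono (inter_subset_inter_left h.pair_subset)
  refine ⟨mem_interOfSize.2 ⟨by rw [card_image_of_injOn (h.injOn_recode h𝓑), h1], ?_⟩,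
    (h.mem_image_recode h𝓑).2 (Or.inr (Or.inl rfl)), ?_⟩
  · intro Z hZ Z' hZ'
    rcases hkept Z hZ with ⟨h2, h3, h4, h5⟩ | ⟨M, rfl, hM⟩ <;>
    rcases hkept Z' hZ' with ⟨h2', h3', h4', h5'⟩ | ⟨M', rfl, hM'⟩
    · rcases h4 with h4 | rfl <;> rcases h4' with h4' | rfl
      · exact hI _ h4 _ h4'
      · exact hmeetA _ h4
      · rw [inter_comm]; exact hmeetA _ h4'
      · rw [inter_self]; exact card_pos.1 (by omega)
    · exact hmix Z M' h2 h3 h5 hM'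
    · rw [inter_comm]
      exact hmix Z' M h2' h3' h5' hM
    · rw [← compl_union, nonempty_iff_ne_empty, Ne, compl_eq_empty_iff]
      intro hu
      have h6 := card_union_le M M'
      rw [hu, card_univ] at h6
      have := h.card_le_of_removed (hweak M hM)
      have := h.card_le_of_removed (hweak M' hM')
      omega
  · intro Z hZ
    rcases hkept Z hZ with ⟨h2, h3, -⟩ | ⟨M, rfl, hM⟩
    · exact ⟨h2, h3⟩
    · have h4 := h.compl_card_lt (hweak M hM)
      have h5 := h.three_le
      have h6 := h.card_le
      refine ⟨by omega, fun hc => ?_⟩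
      have := h.card_le_of_mem _ hc
      omega

lemma subset_of_image_recode_eq (h : RecodeData Q A 𝓝 G) {𝓒 : Finset (Finset α)}
    (h𝓑 : 𝓑 ∈ pureFams s Q) (h𝓒 : 𝓒 ∈ pureFams s Q)
    (he : 𝓑.image (recode Q A 𝓝 G 𝓑) = 𝓒.image (recode Q A 𝓝 G 𝓒)) : 𝓑 ⊆ 𝓒 := by
  have hQN := h.pair_notMem
  have hQG : ∀ L ∈ 𝓝, Q ≠ G L := fun L hL => h.pair_ne_code hL
  have hGN := h.code_notMem
  have hinj' : ∀ L ∈ 𝓝, ∀ L' ∈ 𝓝, G L = G L' → L = L' := fun L hL L' hL' => h.injOn hL hL'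
  have hA1 : A ≠ Qᶜ := h.ne_compl (Or.inl rfl)
  have hA2 : ∀ L ∈ 𝓝, A ≠ Lᶜ := fun L hL => h.ne_compl (Or.inr (Or.inl hL))
  have hA3 : ∀ L ∈ 𝓝, A ≠ (G L)ᶜ := fun L hL => h.ne_compl (Or.inr (Or.inr ⟨L, hL, rfl⟩))
  have hci : ∀ M M' : Finset α, Mᶜ = M'ᶜ → M = M' := fun _ _ he => compl_injective he
  have facts : ∀ 𝓓 ∈ pureFams s Q, Q ∈ 𝓓 ∧ (∀ M ∈ 𝓓, Mᶜ ∉ 𝓓) ∧ (∀ T ∈ 𝓓, T ≠ Qᶜ) ∧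
      ∀ T ∈ 𝓓, ∀ L ∈ 𝓝, T ≠ (G L)ᶜ := by
    intro 𝓓 h𝓓
    have hd : ∀ T ∈ 𝓓, ∀ M, Q ⊆ M → T ≠ Mᶜ := fun T hT M hM he =>
      meets_of_pure h𝓓 hT (he ▸ disjoint_compl_right.mono_left hM)
    exact ⟨(mem_pureFams.1 h𝓓).2.1, fun M hM => (mem_pureFams.1 h𝓓).1.2.1.compl_notMem hM,
      fun T hT => hd T hT Q Subset.rfl, fun T hT L hL => hd T hT _ (h.subset_code L hL)⟩
  have markA : ∀ 𝓓 ∈ pureFams s Q, (Qᶜ ∈ 𝓓.image (recode Q A 𝓝 G 𝓓) ↔ A ∈ 𝓓) := by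
    intro 𝓓 h𝓓
    obtain ⟨f1, f2, f3, f4⟩ := facts 𝓓 h𝓓
    rw [h.mem_image_recode h𝓓]
    refine ⟨?_, fun hA => Or.inr (Or.inr (Or.inl ⟨hA, rfl⟩))⟩
    rintro (⟨h1, -⟩ | h1 | ⟨h1, -⟩ | ⟨L, h1, -, h2⟩ | ⟨L, h1, -, -, h2⟩)
    · exact absurd rfl (f3 _ h1)
    · exact absurd h1.symm hA1
    · exact h1
    · exact absurd (hci _ _ h2) (hQG L h1)
    · exact absurd (hci _ _ h2 ▸ h1) hQN
  have markN : ∀ 𝓓 ∈ pureFams s Q, ∀ L ∈ 𝓝,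
      ((G L)ᶜ ∈ 𝓓.image (recode Q A 𝓝 G 𝓓) ↔ L ∈ 𝓓) := by
    intro 𝓓 h𝓓 L hL
    obtain ⟨f1, f2, f3, f4⟩ := facts 𝓓 h𝓓
    rw [h.mem_image_recode h𝓓]
    refine ⟨?_, fun hLD => Or.inr (Or.inr (Or.inr (Or.inl ⟨L, hL, hLD, rfl⟩)))⟩
    rintro (⟨h1, -⟩ | h1 | ⟨-, h1⟩ | ⟨L', h1, h2, h3⟩ | ⟨L', h1, -, -, h3⟩)
    · exact absurd rfl (f4 _ h1 L hL)
    · exact absurd h1.symm (hA3 L hL)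
    · exact absurd (hci _ _ h1).symm (hQG L hL)
    · rwa [hinj' L hL L' h1 (hci _ _ h3)]
    · exact absurd (hci _ _ h3 ▸ h1) (hGN L hL)
  have markG : ∀ 𝓓 ∈ pureFams s Q, ∀ L ∈ 𝓝, L ∈ 𝓓 →
      (Lᶜ ∈ 𝓓.image (recode Q A 𝓝 G 𝓓) ↔ G L ∈ 𝓓) := by
    intro 𝓓 h𝓓 L hL hLD
    obtain ⟨f1, f2, f3, f4⟩ := facts 𝓓 h𝓓
    rw [h.mem_image_recode h𝓓]
    refine ⟨?_, fun hG => Or.inr (Or.inr (Or.inr (Or.inr ⟨L, hL, hLD, hG, rfl⟩)))⟩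
    rintro (⟨h1, -⟩ | h1 | ⟨-, h1⟩ | ⟨L', h1, -, h3⟩ | ⟨L', h1, -, h2, h3⟩)
    · exact absurd h1 (f2 _ hLD)
    · exact absurd h1.symm (hA2 L hL)
    · exact absurd (hci _ _ h1 ▸ hL) hQN
    · exact absurd (hci _ _ h3 ▸ hL) (hGN L' h1)
    · rwa [hci _ _ h3]
  have eA : A ∈ 𝓑 ↔ A ∈ 𝓒 := by rw [← markA 𝓑 h𝓑, he, markA 𝓒 h𝓒]
  have eN : ∀ L ∈ 𝓝, (L ∈ 𝓑 ↔ L ∈ 𝓒) := fun L hL => by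
    rw [← markN 𝓑 h𝓑 L hL, he, markN 𝓒 h𝓒 L hL]
  have eG : ∀ L ∈ 𝓝, L ∈ 𝓑 → (G L ∈ 𝓑 ↔ G L ∈ 𝓒) := fun L hL hLB => by
    rw [← markG 𝓑 h𝓑 L hL hLB, he, markG 𝓒 h𝓒 L hL ((eN L hL).1 hLB)]
  obtain ⟨f1, f2, f3, f4⟩ := facts 𝓑 h𝓑
  intro T hT
  by_cases h1 : T = Q
  · exact h1 ▸ (facts 𝓒 h𝓒).1
  by_cases h2 : T = A
  · subst h2; exact eA.1 hT
  by_cases h3 : T ∈ 𝓝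
  · exact (eN T h3).1 hT
  by_cases h4 : ∃ L ∈ 𝓝, L ∈ 𝓑 ∧ G L = T
  · obtain ⟨L, hL, hLB, rfl⟩ := h4
    exact (eG L hL hLB).1 hT
  · have hm : T ∈ 𝓑.image (recode Q A 𝓝 G 𝓑) :=
      (h.mem_image_recode h𝓑).2 (Or.inl ⟨hT, h1, h3, fun L hL hLB hc => h4 ⟨L, hL, hLB, hc⟩⟩)
    rw [he, h.mem_image_recode h𝓒] at hm
    rcases hm with ⟨h5, -⟩ | h5 | ⟨-, h5⟩ | ⟨L, h5, -, h6⟩ | ⟨L, h5, h6, -, h7⟩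
    · exact h5
    · exact absurd h5 h2
    · exact absurd h5 (f3 T hT)
    · exact absurd h6 (f4 T hT L h5)
    · exact absurd (h7 ▸ hT) (f2 L ((eN L h5).2 h6))

lemma injOn_image_recode (h : RecodeData Q A 𝓝 G) :
    Set.InjOn (fun 𝓑 : Finset (Finset α) => 𝓑.image (recode Q A 𝓝 G 𝓑))
      (pureFams s Q : Set (Finset (Finset α))) := fun _ h𝓑 _ h𝓒 he =>
  (h.subset_of_image_recode_eq h𝓑 h𝓒 he).antisymm (h.subset_of_image_recode_eq h𝓒 h𝓑 he.symm)

lemma compl_mem_of_disjoint (h : RecodeData Q A 𝓝 G) (h𝓑 : 𝓑 ∈ pureFams s Q) {Z : Finset α}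
    (hZ : Z ∈ 𝓑.image (recode Q A 𝓝 G 𝓑)) (hd : Disjoint Q Z) :
    Zᶜ ∈ insert Q (𝓝 ∪ 𝓝.image G) := by
  simp only [mem_insert, mem_union, mem_image]
  rcases (h.mem_image_recode h𝓑).1 hZ with
    ⟨h2, -⟩ | rfl | ⟨-, rfl⟩ | ⟨L, h2, -, rfl⟩ | ⟨L, h2, -, -, rfl⟩
  · exact absurd hd (meets_of_pure h𝓑 h2)
  · have := h.card_pair
    rw [(disjoint_self_iff_empty Q).1 (hd.mono_right h.pair_subset)] at this
    simp at this
  · simp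
  · exact Or.inr (Or.inr ⟨L, h2, (compl_compl _).symm⟩)
  · exact Or.inr (Or.inl (by rwa [compl_compl]))

lemma mem_image_of_notMem (h : RecodeData Q A 𝓝 G) (h𝓑 : 𝓑 ∈ pureFams s Q) {Z : Finset α}
    (hZ : Z ∈ 𝓑) (hn : Z ∉ insert Q (𝓝 ∪ 𝓝.image G)) : Z ∈ 𝓑.image (recode Q A 𝓝 G 𝓑) := by
  simp only [mem_insert, mem_union, mem_image, not_or, not_exists, not_and] at hn
  exact (h.mem_image_recode h𝓑).2 (Or.inl ⟨hZ, hn.1, hn.2.1, fun L hL _ => hn.2.2 L hL⟩)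

end RecodeData

end

section

lemma eq_of_insert_eq_insert {β : Type*} [DecidableEq β] {Q : Finset β} {w w' : β} (hw : w ∉ Q)
    (h : insert w Q = insert w' Q) : w = w' := by
  have : w ∈ insert w' Q := h ▸ mem_insert_self w Q
  exact (mem_insert.1 this).resolve_right hw

variable {α : Type*} [Fintype α] [DecidableEq α]

lemma card_le_card_pure_add {s : ℕ} {Q : Finset α} (hQ : #Q = 2)
    {𝓢 : Finset (Finset (Finset α))} (h𝓢 : ∀ 𝓑 ∈ 𝓢, 𝓑 ∈ thickFams α s ∧ Q ∈ 𝓑) :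
    #𝓢 ≤ #{𝓑 ∈ 𝓢 | 𝓑 ∈ pureFams s Q} + (Fintype.card α).choose 2 * starNum α s 2 := by
  have hsub : 𝓢 ⊆ {𝓑 ∈ 𝓢 | 𝓑 ∈ pureFams s Q} ∪
      {P ∈ powersetCard 2 (univ : Finset α) | P ≠ Q}.biUnion
        fun P => {𝓑 ∈ thickFams α s | {P, Q} ⊆ 𝓑} := by
    intro 𝓑 h𝓑
    obtain ⟨h1, h2⟩ := h𝓢 𝓑 h𝓑
    by_cases hp : 𝓑 ∈ pureFams s Q
    · exact mem_union_left _ (mem_filter.2 ⟨h𝓑, hp⟩)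
    · rw [pureFams, mem_filter] at hp
      push Not at hp
      obtain ⟨P, hP, hP2, hPQ⟩ := hp h1 h2
      refine mem_union_right _ (mem_biUnion.2 ⟨P, ?_, ?_⟩)
      · simp [mem_powersetCard, hP2, hPQ]
      · simp [h1, h2, hP, insert_subset_iff]
  refine (card_le_card hsub).trans ((card_union_le _ _).trans (Nat.add_le_add_left ?_ _))
  refine (card_biUnion_le_card_mul _ _ (starNum α s 2) fun P hP => ?_).trans
    (Nat.mul_le_mul_right _ ?_)
  · obtain ⟨h1, h2⟩ := mem_filter.1 hP
    exact numContaining_two_le s (mem_powersetCard.1 h1).2 hQ h2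
  · refine (card_filter_le _ _).trans ?_
    rw [card_powersetCard, card_univ]

lemma card_add_le_of_down {𝓛 : Finset (Finset α)} (hdown : ∀ L ∈ 𝓛, ∀ T ⊆ L, T ∈ 𝓛)
    (hmem : ∀ T, #T ≤ 1 → T ∈ 𝓛) {A : Finset α} (hA : A ∈ 𝓛) (h3 : 3 ≤ #A) {a b : α}
    (ha : a ∈ A) :
    Fintype.card α + 1 + (#A - 1 + #{w ∈ Aᶜ | insert w {a, b} ∈ 𝓛}) +
      (#{L ∈ 𝓛.erase A | 3 ≤ #L} + 1) ≤ #𝓛 := by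
  have haS : a ∉ A.erase a ∪ {w ∈ Aᶜ | insert w {a, b} ∈ 𝓛} := by simp [ha]
  have hc1 : #(A.erase a ∪ {w ∈ Aᶜ | insert w {a, b} ∈ 𝓛}) =
      #A - 1 + #{w ∈ Aᶜ | insert w {a, b} ∈ 𝓛} := by
    rw [card_union_of_disjoint, card_erase_of_mem ha]
    rw [disjoint_left]
    intro w hw hw'
    simp only [mem_filter, mem_compl] at hw'
    exact hw'.1 (mem_of_mem_erase hw)
  have hc2 : #(starPairs a (A.erase a ∪ {w ∈ Aᶜ | insert w {a, b} ∈ 𝓛})) =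
      #(A.erase a ∪ {w ∈ Aᶜ | insert w {a, b} ∈ 𝓛}) :=
    card_image_of_injective _ (pair_right_injective a)
  have hpair : ∀ T ∈ starPairs a (A.erase a ∪ {w ∈ Aᶜ | insert w {a, b} ∈ 𝓛}),
      #T = 2 ∧ T ∈ 𝓛 := by
    intro T hT
    obtain ⟨y, hy, rfl⟩ := mem_image.1 hT
    have hay : a ≠ y := fun hc => haS (hc ▸ hy)
    refine ⟨card_pair hay, ?_⟩
    rcases mem_union.1 hy with hy | hy
    · exact hdown A hA _ (by simp [insert_subset_iff, ha, mem_of_mem_erase hy])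
    · exact hdown _ (mem_filter.1 hy).2 _ (by simp [insert_subset_iff])
  rw [← card_filter_card_le_one, ← hc1, ← hc2, ← card_insert_of_notMem (a := A) (by simp),
    ← card_union_of_disjoint, ← card_union_of_disjoint]
  · refine card_le_card (union_subset (union_subset ?_ ?_) ?_)
    · exact fun T hT => hmem T (mem_filter.1 hT).2
    · exact fun T hT => (hpair T hT).2
    · refine insert_subset hA ((filter_subset _ _).trans (erase_subset _ _))
  · rw [disjoint_left]
    intro T hT hT'
    have h1 : #T ≤ 2 := by
      rcases mem_union.1 hT with hT | hT
      · exact (mem_filter.1 hT).2.trans (by norm_num)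
      · exact (hpair T hT).1.le
    rcases mem_insert.1 hT' with rfl | hT'
    · omega
    · have := (mem_filter.1 hT').2
      omega
  · rw [disjoint_left]
    intro T hT hT'
    have h1 := (mem_filter.1 hT).2
    have h2 := (hpair T hT').1
    omega

lemma exists_recodeData {𝓛 : Finset (Finset α)} (hcard : #𝓛 = 2 * Fintype.card α)
    (hsize : ∀ L ∈ 𝓛, 2 * #L + 2 ≤ Fintype.card α) (hdown : ∀ L ∈ 𝓛, ∀ T ⊆ L, T ∈ 𝓛)
    (hmem : ∀ T, #T ≤ 1 → T ∈ 𝓛) {A : Finset α} (hA : A ∈ 𝓛) (hmax : ∀ L ∈ 𝓛, #L ≤ #A)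
    (h3 : 3 ≤ #A) {a b : α} (hab : a ≠ b) (ha : a ∈ A) (hb : b ∈ A) :
    ∃ G, RecodeData {a, b} A {L ∈ 𝓛.erase A | 3 ≤ #L} G := by
  set 𝓝 := {L ∈ 𝓛.erase A | 3 ≤ #L} with h𝓝
  have h𝓝m : ∀ {L}, L ∈ 𝓝 ↔ (L ≠ A ∧ L ∈ 𝓛) ∧ 3 ≤ #L := by
    intro L; rw [h𝓝, mem_filter, mem_erase]
  have hcount := card_add_le_of_down hdown hmem hA h3 (b := b) ha
  rw [← h𝓝, hcard] at hcount
  have hsplit := card_filter_add_card_filter_not (s := Aᶜ) fun w => insert w {a, b} ∈ 𝓛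
  rw [card_compl] at hsplit
  have hAn := hsize A hA
  have hle : Fintype.card 𝓝 ≤ Fintype.card {w ∈ Aᶜ | insert w {a, b} ∉ 𝓛} := by
    rw [Fintype.card_coe, Fintype.card_coe]
    omega
  obtain ⟨e⟩ := Function.Embedding.nonempty_of_card_le hle
  have he : ∀ L, (e L : α) ∉ A ∧ insert (e L : α) {a, b} ∉ 𝓛 := by
    intro L
    have := (e L).2
    rwa [mem_filter, mem_compl] at this
  have hQA : ({a, b} : Finset α) ⊆ A := by simp [insert_subset_iff, ha, hb]
  have heQ : ∀ L, (e L : α) ∉ ({a, b} : Finset α) := fun L hc => (he L).1 (hQA hc)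
  refine ⟨fun L => if h : L ∈ 𝓝 then insert (e ⟨L, h⟩ : α) {a, b} else ∅, ?_⟩
  exact
    { card_pair := card_pair hab
      pair_subset := hQA
      three_le := h3
      card_le := hAn
      notMem := fun h => (h𝓝m.1 h).1.1 rfl
      three_le_of_mem := fun L hL => (h𝓝m.1 hL).2
      card_le_of_mem := fun L hL => hsize L (h𝓝m.1 hL).1.2
      down := by
        intro L hL T hT hT3
        obtain ⟨⟨h1, h2⟩, -⟩ := h𝓝m.1 hL
        refine h𝓝m.2 ⟨⟨?_, hdown L h2 T hT⟩, hT3⟩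
        rintro rfl
        exact h1 (eq_of_subset_of_card_le hT (hmax L h2)).symm
      injOn := by
        intro L hL L' hL' h
        rw [mem_coe] at hL hL'
        simp only [dif_pos hL, dif_pos hL'] at h
        have := e.injective (Subtype.ext (eq_of_insert_eq_insert (heQ ⟨L, hL⟩) h))
        exact congrArg Subtype.val this
      card_code := by
        intro L hL
        rw [dif_pos hL, card_insert_of_notMem (heQ _), card_pair hab]
      subset_code := by
        intro L hL
        rw [dif_pos hL]
        exact subset_insert _ _
      code_notMem := by
        intro L hL hc
        rw [dif_pos hL] at hc
        exact (he _).2 (h𝓝m.1 hc).1.2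
      code_ne := by
        intro L hL hc
        rw [dif_pos hL] at hc
        refine (he ⟨L, hL⟩).2 ?_
        rwa [hc] }

lemma exists_pair_notMem {𝓛 : Finset (Finset α)} (hn : 21 ≤ Fintype.card α)
    (hcard : #𝓛 = 2 * Fintype.card α) : ∃ P ∉ 𝓛, #P = 2 := by
  by_contra! hc
  have hsub : powersetCard 2 (univ : Finset α) ⊆ 𝓛 := by
    intro P hP
    by_contra hP'
    exact hc P hP' (mem_powersetCard.1 hP).2
  have h1 := card_le_card hsub
  rw [card_powersetCard, card_univ, hcard, Nat.choose_two_right,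
    Nat.div_le_iff_le_mul_add_pred (by norm_num)] at h1
  have h2 : 20 * Fintype.card α ≤ Fintype.card α * (Fintype.card α - 1) := by
    rw [Nat.mul_comm 20]
    exact Nat.mul_le_mul_left _ (by omega)
  omega

lemma two_pow_gt {n : ℕ} (hn : 21 ≤ n) :
    4 * n.choose 2 + 2 * (4 * n + 3) < 2 ^ (n - 3) := by
  have h1 : 4 * n.choose 2 ≤ 2 * (n * n) := by
    have h2 : n.choose 2 * 2 ≤ n * (n - 1) := by
      rw [Nat.choose_two_right]; exact Nat.div_mul_le_self _ _
    have h3 : n * (n - 1) ≤ n * n := Nat.mul_le_mul_left _ (by omega)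
    omega
  refine lt_of_le_of_lt (Nat.add_le_add_right h1 _) ?_
  clear h1
  induction n, hn using Nat.le_induction with
  | base => norm_num
  | succ n hn ih =>
    rw [show n + 1 - 3 = (n - 3) + 1 by omega, pow_succ]
    nlinarith

set_option maxHeartbeats 1000000 in
/-- A best down-closed family of `2n` small sets has no member of size three or more. -/
lemma IsBest.card_le_two {s : ℕ} (hs1 : 2 ≤ s) (hs2 : s ≤ 2 ^ (Fintype.card α - 1))
    (hn : 21 ≤ Fintype.card α) {𝓛 : Finset (Finset α)} (hbest : IsBest s 𝓛)
    (hcard : #𝓛 = 2 * Fintype.card α) (hsize : ∀ L ∈ 𝓛, 2 * #L + 2 ≤ Fintype.card α)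
    (hdown : ∀ L ∈ 𝓛, ∀ T ⊆ L, T ∈ 𝓛) (hmem : ∀ T, #T ≤ 1 → T ∈ 𝓛) : ∀ L ∈ 𝓛, #L ≤ 2 := by
  by_contra! hc
  obtain ⟨L₀, hL₀, hL₀3⟩ := hc
  obtain ⟨A, hA, hmax⟩ := exists_max_image 𝓛 card ⟨L₀, hL₀⟩
  have h3 : 3 ≤ #A := hL₀3.trans_le (hmax L₀ hL₀)
  obtain ⟨T₀, hT₀A, hT₀⟩ := exists_subset_card_eq h3
  obtain ⟨a, b, c, hab, hac, hbc, rfl⟩ := card_eq_three.1 hT₀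
  have ha : a ∈ A := hT₀A (by simp)
  have hb : b ∈ A := hT₀A (by simp)
  have hc : c ∈ A := hT₀A (by simp)
  obtain ⟨G, hG⟩ := exists_recodeData hcard hsize hdown hmem hA hmax h3 hab ha hb
  obtain ⟨G', hG'⟩ := exists_recodeData hcard hsize hdown hmem hA hmax h3 hac ha hc
  set 𝓝 := {L ∈ 𝓛.erase A | 3 ≤ #L} with h𝓝
  have h𝓝n : #𝓝 ≤ Fintype.card α := by
    have := card_add_le_of_down hdown hmem hA h3 (b := b) ha
    rw [← h𝓝, hcard] at this
    omega
  obtain ⟨P, hP𝓛, hP2⟩ := exists_pair_notMem hn hcard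
  set 𝓨 := {𝓑 ∈ interOfSize α s | A ∈ 𝓑 ∧ Disjoint 𝓑 (insert P (𝓛.erase A))} with h𝓨
  have hY : #𝓨 ≤ starNum α s 1 := by
    refine (hbest.swap_le hA hP𝓛).trans ?_
    rw [← numContaining_pair s hP2, numContaining]
    refine card_le_card fun 𝓑 h𝓑 => ?_
    obtain ⟨h1, h2, h4⟩ := mem_filter.1 h𝓑
    obtain ⟨h5, h6⟩ := mem_interOfSize.1 h1
    refine mem_filter.2 ⟨mem_thickFams.2 ⟨h5, h6, fun T hT => ?_⟩, by simpa using h2⟩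
    by_contra hT'
    exact disjoint_left.1 h4 hT (hmem T (by omega))
  have himage : ∀ {Q : Finset α} {F : Finset α → Finset α}, RecodeData Q A 𝓝 F →
      ∀ 𝓑 ∈ pureFams s Q, 𝓑.image (recode Q A 𝓝 F 𝓑) ∈ 𝓨 := by
    intro Q F hF 𝓑 h𝓑
    obtain ⟨h1, h2, h4⟩ := hF.image_recode_spec h𝓑
    refine mem_filter.2 ⟨h1, h2, disjoint_left.2 fun T hT hT' => ?_⟩
    obtain ⟨h5, h6⟩ := h4 T hT
    rcases mem_insert.1 hT' with rfl | hT'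
    · omega
    · exact h6 (mem_filter.2 ⟨hT', h5⟩)
  set W := (insert a {b, c} : Finset α)ᶜ with hW
  have hWn : #W = Fintype.card α - 3 := by rw [hW, card_compl, hT₀]
  set 𝓧 : Finset (Finset α) := insert W ((insert {a, b} (𝓝 ∪ 𝓝.image G)).image (· \ {a, b}) ∪
    (insert {a, c} (𝓝 ∪ 𝓝.image G')).image fun Z => Zᶜ \ {a, b}) with h𝓧
  have h𝓧n : #𝓧 ≤ 4 * Fintype.card α + 3 := by
    have hbound : ∀ (Q : Finset α) (F f : Finset α → Finset α),
        #((insert Q (𝓝 ∪ 𝓝.image F)).image f) ≤ 2 * Fintype.card α + 1 := by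
      intro Q F f
      have h1 : #(insert Q (𝓝 ∪ 𝓝.image F)) ≤ #(𝓝 ∪ 𝓝.image F) + 1 := card_insert_le _ _
      have h2 := card_union_le 𝓝 (𝓝.image F)
      have h4 : #(𝓝.image F) ≤ #𝓝 := card_image_le
      exact card_image_le.trans (by omega)
    rw [h𝓧]
    refine (card_insert_le _ _).trans ?_
    have := (card_union_le _ _).trans (Nat.add_le_add (hbound {a, b} G (· \ {a, b}))
      (hbound {a, c} G' fun Z => Zᶜ \ {a, b}))
    omega
  have hgain := numContaining_star_gain s (x := a) (v := b) (V := {b, c})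
    (by simp [hab, hac]) (by simp) (by rw [card_pair hbc]) 𝓧 (mem_insert_self _ _)
  rw [numContaining_starPairs s (by simp [hab, hac]), card_pair hbc, ← hW, hWn,
    show ({b, c} : Finset α).erase b = {c} by ext t; simp; grind] at hgain
  set 𝓢 := {𝓑 ∈ thickFams α s | starPairs a {c} ⊆ 𝓑 ∧
    ∃ R ⊆ W, R ∉ 𝓧 ∧ (insert a (insert b R))ᶜ ∈ 𝓑} with h𝓢
  have h𝓢' := card_le_card_pure_add (s := s) (card_pair hac) (𝓢 := 𝓢) fun 𝓑 h𝓑 => by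
    obtain ⟨h1, h2, -⟩ := mem_filter.1 h𝓑
    exact ⟨h1, h2 (by simp [starPairs])⟩
  have hpure : starNum α s 1 ≤ #(pureFams s {a, b}) +
      (Fintype.card α).choose 2 * starNum α s 2 := by
    rw [← numContaining_pair s (card_pair hab), numContaining]
    refine (card_le_card_pure_add (s := s) (card_pair hab)
      (𝓢 := {𝓑 ∈ thickFams α s | {{a, b}} ⊆ 𝓑}) fun 𝓑 h𝓑 => ?_).trans
      (Nat.add_le_add_right (card_le_card fun 𝓑 h𝓑 => (mem_filter.1 h𝓑).2) _)
    obtain ⟨h1, h2⟩ := mem_filter.1 h𝓑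
    exact ⟨h1, by simpa using h2⟩
  have hdisj : Disjoint
      ((pureFams s {a, b}).image fun 𝓑 => 𝓑.image (recode {a, b} A 𝓝 G 𝓑))
      ({𝓑 ∈ 𝓢 | 𝓑 ∈ pureFams s {a, c}}.image fun 𝓑 => 𝓑.image (recode {a, c} A 𝓝 G' 𝓑)) := by
    rw [disjoint_left]
    intro 𝓒 h𝓒 h𝓒'
    obtain ⟨𝓑, h𝓑, rfl⟩ := mem_image.1 h𝓒
    obtain ⟨𝓑', h𝓑', he⟩ := mem_image.1 h𝓒'
    obtain ⟨h1, h2⟩ := mem_filter.1 h𝓑'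
    obtain ⟨-, -, R, hRW, hR𝓧, hR⟩ := mem_filter.1 h1
    have hRab : insert a (insert b R) \ {a, b} = R := by
      have haR : a ∉ R := fun hc => by simpa [hW] using hRW hc
      have hbR : b ∉ R := fun hc => by simpa [hW] using hRW hc
      ext t
      simp only [mem_sdiff, mem_insert, mem_singleton, not_or]
      constructor
      · tauto
      · intro ht
        exact ⟨Or.inr (Or.inr ht), fun hc => haR (hc ▸ ht), fun hc => hbR (hc ▸ ht)⟩
    have h4 : (insert a (insert b R))ᶜ ∈ 𝓑'.image (recode {a, c} A 𝓝 G' 𝓑') := by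
      refine hG'.mem_image_of_notMem h2 hR fun hc => hR𝓧 ?_
      refine mem_insert_of_mem (mem_union_right _ (mem_image.2 ⟨_, hc, ?_⟩))
      rw [compl_compl, hRab]
    have h5 := hG.compl_mem_of_disjoint h𝓑 (he ▸ h4)
      (disjoint_compl_right.mono_left (by simp [insert_subset_iff]))
    rw [compl_compl] at h5
    exact hR𝓧 (mem_insert_of_mem (mem_union_left _ (mem_image.2 ⟨_, h5, hRab⟩)))
  have htotal : #(pureFams s {a, b}) + #{𝓑 ∈ 𝓢 | 𝓑 ∈ pureFams s {a, c}} ≤ #𝓨 := by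
    have hsub : {𝓑 ∈ 𝓢 | 𝓑 ∈ pureFams s {a, c}} ⊆ pureFams s {a, c} :=
      fun 𝓑 h𝓑 => (mem_filter.1 h𝓑).2
    rw [← card_image_of_injOn hG.injOn_image_recode,
      ← card_image_of_injOn (hG'.injOn_image_recode.mono (coe_subset.2 hsub)),
      ← card_union_of_disjoint hdisj]
    exact card_le_card (union_subset (image_subset_iff.2 fun 𝓑 h𝓑 => himage hG 𝓑 h𝓑)
      (image_subset_iff.2 fun 𝓑 h𝓑 => himage hG' 𝓑 (hsub h𝓑)))
  have hpos : 0 < starNum α s 2 := starNum_two_pos hs1 hs2 (by omega)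
  have hpow := two_pow_gt hn
  have h1 : 2 * #𝓧 * starNum α s 2 ≤ 2 * (4 * Fintype.card α + 3) * starNum α s 2 :=
    Nat.mul_le_mul_right _ (Nat.mul_le_mul_left _ h𝓧n)
  have h2 := Nat.mul_lt_mul_of_pos_right hpow hpos
  rw [Nat.add_mul, Nat.mul_assoc 4] at h2
  omega

end

section

variable {α : Type*} [Fintype α] [DecidableEq α]

/-- The families of `2n` sets avoided by the most intersecting families are the star
complements. -/
theorem isBest_iff {s : ℕ} (hs1 : 2 ≤ s) (hs2 : s ≤ 2 ^ (Fintype.card α - 1))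
    (hn : 21 ≤ Fintype.card α) {𝓛 : Finset (Finset α)} (hcard : #𝓛 = 2 * Fintype.card α) :
    IsBest s 𝓛 ↔ ∃ x, 𝓛 = starComplement x := by
  have key : ∀ 𝓛 : Finset (Finset α), #𝓛 = 2 * Fintype.card α → IsBest s 𝓛 →
      ∃ x, 𝓛 = starComplement x := by
    refine isBest_of_downsets hs1 hs2 (by omega) _ fun 𝓛 hcard hbest hdown => ?_
    have hsize : ∀ L ∈ 𝓛, 2 * #L + 2 ≤ Fintype.card α := fun L hL =>
      two_mul_add_two_le hn (hcard ▸ two_pow_card_le_of_down hdown hL)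
    have hsing := hbest.singleton_mem hs1 hs2 (by omega) (by omega) hsize
    have hmem : ∀ T : Finset α, #T ≤ 1 → T ∈ 𝓛 := by
      intro T hT
      have : Nonempty α := Fintype.card_pos_iff.1 (by omega)
      obtain ⟨x, hx⟩ := card_le_one_iff_subset_singleton.1 hT
      exact hdown _ (hsing x) T hx
    exact hbest.eq_starComplement hs1 hs2 hn hcard
      (hbest.card_le_two hs1 hs2 hn hcard hsize hdown hmem) hmem
  refine ⟨key 𝓛 hcard, ?_⟩
  rintro ⟨x, rfl⟩ 𝓛' h𝓛'
  obtain ⟨𝓜, h𝓜, hmax⟩ := exists_max_image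
    (powersetCard (2 * Fintype.card α) (univ : Finset (Finset α))) (countAvoiding s)
    ⟨starComplement x, by simp [mem_powersetCard, hcard]⟩
  have h𝓜c := (mem_powersetCard.1 h𝓜).2
  have hle : ∀ 𝓛', #𝓛' = 2 * Fintype.card α → countAvoiding s 𝓛' ≤ countAvoiding s 𝓜 :=
    fun 𝓛' h => hmax 𝓛' (by simp [mem_powersetCard, h])
  obtain ⟨y, rfl⟩ := key 𝓜 h𝓜c fun 𝓛' h => hle 𝓛' (h.trans h𝓜c)
  refine (hle 𝓛' (h𝓛'.trans hcard)).trans_eq ?_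
  rw [← countAvoiding_permFam s (Equiv.swap y x) (starComplement y), permFam_starComplement,
    Equiv.swap_apply_left]

end

/-- Views a set of elements of `[n]` as a set of natural numbers. -/
def liftSet (n : ℕ) : Finset (groundSet n) ↪ Finset ℕ :=
  (mapEmbedding (Function.Embedding.subtype (· ∈ groundSet n))).toEmbedding

lemma liftSet_apply {n : ℕ} (T : Finset (groundSet n)) :
    liftSet n T = T.map (Function.Embedding.subtype (· ∈ groundSet n)) := rfl

lemma card_liftSet {n : ℕ} (T : Finset (groundSet n)) : #(liftSet n T) = #T := card_map _

lemma coe_mem_liftSet {n : ℕ} {T : Finset (groundSet n)} {x : groundSet n} :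
    (x : ℕ) ∈ liftSet n T ↔ x ∈ T := by
  simp [liftSet_apply]

lemma map_liftSet_univ (n : ℕ) : univ.map (liftSet n) = allFams n := by
  ext A
  simp only [mem_map, mem_univ, true_and, allFams, mem_powerset]
  constructor
  · rintro ⟨T, rfl⟩ x hx
    obtain ⟨y, -, rfl⟩ := mem_map.1 hx
    exact y.2
  · intro hA
    exact ⟨A.subtype (· ∈ groundSet n), subtype_map_of_mem hA⟩

lemma card_interFams_map {n : ℕ} (s : ℕ) (𝓑 : Finset (Finset (groundSet n))) :
    #(interFams s (𝓑.map (liftSet n))) = countAvoiding s 𝓑ᶜ := by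
  rw [interFams, powersetCard_map, filter_map, card_map, countAvoiding]
  congr 1
  ext 𝓒
  simp only [mem_filter, mem_powersetCard, mem_interOfSize, disjoint_compl_right_iff,
    Function.comp_apply]
  have : (∀ B ∈ 𝓒.map (liftSet n), ∀ B' ∈ 𝓒.map (liftSet n), (B ∩ B').Nonempty) ↔
      IsInter 𝓒 := by
    simp only [forall_mem_map, IsInter, liftSet_apply, ← map_inter, map_nonempty]
  rw [← this]
  exact ⟨fun ⟨⟨h1, h2⟩, h3⟩ => ⟨⟨h2, h3⟩, h1⟩, fun ⟨⟨h2, h3⟩, h1⟩ => ⟨⟨h1, h2⟩, h3⟩⟩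

/-- The subsets of `[n]` of size at least three together with the pairs missing `x`. -/
def starFree (n x : ℕ) : Finset (Finset ℕ) := {A ∈ allFams n | 3 ≤ #A ∨ #A = 2 ∧ x ∉ A}

lemma map_compl_starComplement {n : ℕ} (x : groundSet n) :
    (starComplement x)ᶜ.map (liftSet n) = starFree n x := by
  rw [starFree, ← map_liftSet_univ, filter_map]
  congr 1
  ext T
  simp only [starComplement, mem_compl, mem_filter, mem_univ, true_and, Function.comp_apply,
    card_liftSet, coe_mem_liftSet]
  by_cases hx : x ∈ T <;> simp only [hx] <;> grind

lemma layers_eq_starFree (n : ℕ) :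
    (layerGE n 3 ∪ (layerEQ n 2).filter fun A => n ∉ A) = starFree n n := by
  ext A
  simp only [layerGE, layerEQ, starFree, allFams, mem_union, mem_filter, mem_powersetCard,
    mem_powerset]
  tauto

lemma image_starFree {n : ℕ} {σ : Equiv.Perm ℕ} (hσ : ∀ x ∈ groundSet n, σ x ∈ groundSet n)
    (x : ℕ) : (starFree n x).image (fun A => A.image σ) = starFree n (σ x) := by
  have hG : (groundSet n).image σ = groundSet n :=
    eq_of_subset_of_card_le (image_subset_iff.2 hσ) (card_image_of_injective _ σ.injective).ge
  ext A
  simp only [starFree, allFams, mem_image, mem_filter, mem_powerset]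
  constructor
  · rintro ⟨B, ⟨hB, h⟩, rfl⟩
    rw [card_image_of_injective _ σ.injective, σ.injective.mem_finset_image]
    exact ⟨hG ▸ image_subset_image hB, h⟩
  · rintro ⟨hA, h⟩
    have hA' : (A.image σ.symm).image σ = A := by simp [image_image]
    refine ⟨A.image σ.symm, ⟨?_, ?_⟩, hA'⟩
    · rwa [← image_subset_image_iff σ.injective, hA', hG]
    · rw [card_image_of_injective _ σ.symm.injective]
      simpa [Equiv.symm_apply_eq] using h

lemma two_pow_eq_add {n : ℕ} (hn : 2 ≤ n) :
    2 ^ n = (∑ k ∈ Icc 3 n, n.choose k) + (n - 1).choose 2 + 2 * n := by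
  obtain ⟨m, rfl⟩ : ∃ m, n = m + 2 := ⟨n - 2, by omega⟩
  have h1 : ∑ k ∈ Icc 3 (m + 2), (m + 2).choose k = ∑ k ∈ range m, (m + 2).choose (3 + k) := by
    rw [← Ico_add_one_right_eq_Icc, sum_Ico_eq_sum_range]
    rfl
  rw [← Nat.sum_range_choose, h1, sum_range_succ', sum_range_succ', sum_range_succ']
  have h2 : (m + 2).choose 2 = (m + 1) + (m + 1).choose 2 := by
    rw [Nat.choose_succ_succ' (m + 1) 1, Nat.choose_one_right]
  simp only [Nat.choose_zero_right, Nat.zero_add, Nat.choose_one_right, Nat.reduceAdd, h2,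
    Nat.add_assoc, Nat.add_comm 3]
  rw [show m + 2 - 1 = m + 1 by omega]
  omega

end IntersectingCount

open IntersectingCount in
theorem stmt1 (n s : ℕ) (hn : 21 ≤ n) (hs1 : 2 ≤ s) (hs2 : s ≤ 2 ^ (n - 1))
    (𝓐 : Finset (Finset ℕ)) (h𝓐 : 𝓐 ⊆ allFams n)
    (hcard : 𝓐.card = (∑ k ∈ Finset.Icc 3 n, n.choose k) + (n - 1).choose 2) :
    (∀ 𝓐' ⊆ allFams n, 𝓐'.card = 𝓐.card →
        (interFams s 𝓐').card ≤ (interFams s 𝓐).card) ↔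
      ∃ σ : Equiv.Perm ℕ, (∀ x ∈ groundSet n, σ x ∈ groundSet n) ∧
        𝓐 = (layerGE n 3 ∪ (layerEQ n 2).filter fun A => n ∉ A).image
              fun A => A.image σ := by
  have hα : Fintype.card (groundSet n) = n := by
    rw [Fintype.card_coe, groundSet, Nat.card_Icc, Nat.add_sub_cancel]
  obtain ⟨𝓑, -, rfl⟩ := subset_map_iff.1 (h𝓐.trans (map_liftSet_univ n).ge)
  have hcompl : ∀ 𝓒 : Finset (Finset (groundSet n)), #𝓒ᶜ = 2 ^ n - #𝓒 := fun 𝓒 => by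
    rw [card_compl, Fintype.card_finset, hα]
  have hle : ∀ 𝓒 : Finset (Finset (groundSet n)), #𝓒 ≤ 2 ^ n := fun 𝓒 => by
    simpa [hα] using card_le_univ 𝓒
  have hcard' : #𝓑ᶜ = 2 * Fintype.card (groundSet n) := by
    rw [card_map] at hcard
    rw [hcompl, hcard, hα, two_pow_eq_add (by omega), Nat.add_sub_cancel_left]
  have hbest : (∀ 𝓐' ⊆ allFams n, #𝓐' = #(𝓑.map (liftSet n)) →
      #(interFams s 𝓐') ≤ #(interFams s (𝓑.map (liftSet n)))) ↔ IsBest s 𝓑ᶜ := by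
    constructor
    · intro h 𝓛 h𝓛
      have := h (𝓛ᶜ.map (liftSet n)) ((map_subset_map.2 (subset_univ _)).trans
        (map_liftSet_univ n).le) (by
          rw [card_map, card_map, hcompl, h𝓛, hcompl]
          have := hle 𝓑
          omega)
      rwa [card_interFams_map, card_interFams_map, compl_compl] at this
    · intro h 𝓐' h𝓐' hc
      obtain ⟨𝓒, -, rfl⟩ := subset_map_iff.1 (h𝓐'.trans (map_liftSet_univ n).ge)
      rw [card_map, card_map] at hc
      rw [card_interFams_map, card_interFams_map]
      exact h _ (by rw [hcompl, hcompl, hc])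
  rw [hbest, isBest_iff hs1 (by rwa [hα]) (by rwa [hα]) hcard', layers_eq_starFree]
  have hnG : n ∈ groundSet n := by simp [groundSet]; omega
  constructor
  · rintro ⟨x, hx⟩
    have hσ : ∀ y ∈ groundSet n, Equiv.swap n (x : ℕ) y ∈ groundSet n := by
      intro y hy
      rw [Equiv.swap_apply_def]
      split_ifs
      exacts [x.2, hnG, hy]
    refine ⟨Equiv.swap n x, hσ, ?_⟩
    rw [image_starFree hσ, Equiv.swap_apply_left, ← map_compl_starComplement, ← hx, compl_compl]
  · rintro ⟨σ, hσ, h⟩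
    rw [image_starFree hσ, ← map_compl_starComplement ⟨σ n, hσ n hnG⟩] at h
    exact ⟨⟨σ n, hσ n hnG⟩, by rw [map_injective _ h, compl_compl]⟩
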